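/- Let M ≥ 1 be an integer, let α_k, β_k > 0 for k = 1,…,M, let m be a nonnegative integer, and suppose ∑_{k=1}^M α_k > m + (1/2)(M + 3/2) and λ ≥ π·∑_{k=1}^M β_k. Then ∫_0^∞ x^{2m+1}·J_{2m+4}(λx)·g_M(x) dx = ((2m+2)! / (2·∏_{k=1}^M Γ(α_k)^2)) · (2/λ)^{2(m+1)} · [1 − (4(2m+3)/λ^2)·∑_{k=1}^M β_k^2·ψ^{(1)}(α_k)], where ψ^{(1)} denotes the trigamma function (the derivative of the digamma function ψ = Γ'/Γ). -/

import Mathlib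

open MeasureTheory Real

/-- Bessel function of the first kind of nonnegative integer order `n`. -/
noncomputable def besselJ (n : ℕ) (x : ℝ) : ℝ :=
  ∑' k : ℕ, (-1 : ℝ) ^ k / (Nat.factorial k * Nat.factorial (n + k)) * (x / 2) ^ (n + 2 * k)

/-- The product of reciprocal Gamma functions `∏_{k<M} 1/(Γ(α k + β k x) Γ(α k - β k x))`. -/
noncomputable def gammaProd (M : ℕ) (α β : ℕ → ℝ) (x : ℝ) : ℝ :=
  ∏ k ∈ Finset.range M, (Real.Gamma (α k + β k * x) * Real.Gamma (α k - β k * x))⁻¹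

/-- The digamma function `ψ = Γ'/Γ`. -/
noncomputable def digamma (x : ℝ) : ℝ := deriv Real.Gamma x / Real.Gamma x

/-- The `n`-th polygamma function, the `n`-th derivative of the digamma function. -/
noncomputable def polygamma (n : ℕ) (x : ℝ) : ℝ := iteratedDeriv n digamma x

/-! ### Bessel functions -/

/-- The entire function `∑ (-y)^k / (k! (n+k)!)`, for which `J_n(x) = (x/2)^n C_n(x²/4)`. -/
noncomputable def besselClifford (n : ℕ) (y : ℝ) : ℝ :=
  ∑' k : ℕ, (-1 : ℝ) ^ k / (Nat.factorial k * Nat.factorial (n + k)) * y ^ k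

lemma norm_besselClifford_coeff_le (n k : ℕ) :
    ‖(-1 : ℝ) ^ k / (Nat.factorial k * Nat.factorial (n + k))‖ ≤ 1 / (Nat.factorial k : ℝ) := by
  rw [norm_div, norm_pow, norm_neg, norm_one, one_pow, norm_mul]
  simp only [Real.norm_natCast]
  apply one_div_le_one_div_of_le (by positivity)
  have : (1 : ℝ) ≤ Nat.factorial (n + k) := by exact_mod_cast Nat.factorial_pos _
  have h2 : (0 : ℝ) ≤ Nat.factorial k := by positivity
  nlinarith

lemma summable_besselClifford (n : ℕ) (y : ℝ) :
    Summable fun k : ℕ ↦ (-1 : ℝ) ^ k / (Nat.factorial k * Nat.factorial (n + k)) * y ^ k := by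
  refine Summable.of_norm_bounded (Real.summable_pow_div_factorial |y|) fun k ↦ ?_
  rw [norm_mul, norm_pow, Real.norm_eq_abs y, div_eq_mul_one_div (|y| ^ k), mul_comm (|y| ^ k)]
  exact mul_le_mul_of_nonneg_right (norm_besselClifford_coeff_le n k) (by positivity)

lemma besselJ_eq_besselClifford (n : ℕ) (x : ℝ) :
    besselJ n x = (x / 2) ^ n * besselClifford n (x ^ 2 / 4) := by
  rw [besselJ, besselClifford, ← tsum_mul_left]
  refine tsum_congr fun k ↦ ?_
  rw [pow_add, pow_mul]
  ring

lemma besselClifford_recurrence (n : ℕ) (y : ℝ) :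
    besselClifford n y = (n + 1) * besselClifford (n + 1) y - y * besselClifford (n + 2) y := by
  have h0 := (summable_besselClifford n y).hasSum
  have h1 := ((summable_besselClifford (n + 1) y).hasSum.mul_left ((n : ℝ) + 1))
  have h2 := ((summable_besselClifford (n + 2) y).hasSum.mul_left y)
  have h3 := h0.sub h1
  have h4 : HasSum (fun k : ℕ ↦
      (-1 : ℝ) ^ (k + 1) / (Nat.factorial (k + 1) * Nat.factorial (n + (k + 1))) * y ^ (k + 1)
      - ((n : ℝ) + 1) * ((-1 : ℝ) ^ (k + 1) /
        (Nat.factorial (k + 1) * Nat.factorial (n + 1 + (k + 1))) * y ^ (k + 1)))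
      (-(y * besselClifford (n + 2) y)) := by
    refine (congrArg (HasSum · _) (funext fun k ↦ ?_)).mp h2.neg
    have e1 : n + 1 + (k + 1) = n + k + 2 := by ring
    have e2 : n + (k + 1) = n + k + 1 := by ring
    have e3 : n + 2 + k = n + k + 2 := by ring
    rw [e1, e2, e3, Nat.factorial_succ (n + k + 1), Nat.factorial_succ (n + k),
      Nat.factorial_succ k]
    have p1 : (Nat.factorial k : ℝ) ≠ 0 := by positivity
    have p2 : (Nat.factorial (n + k) : ℝ) ≠ 0 := by positivity
    have p3 : (k : ℝ) + 1 ≠ 0 := by positivity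
    have p4 : (n : ℝ) + k + 1 ≠ 0 := by positivity
    have p5 : (n : ℝ) + k + 1 + 1 ≠ 0 := by positivity
    push_cast
    field_simp
    ring
  have h5 := (hasSum_nat_add_iff' 1).2 h3
  have h6 := h4.unique h5
  simp only [Finset.range_one, Finset.sum_singleton] at h6
  have p2 : (Nat.factorial n : ℝ) ≠ 0 := by positivity
  have p3 : (n : ℝ) + 1 ≠ 0 := by positivity
  have h7 : (-1 : ℝ) ^ 0 / (Nat.factorial 0 * Nat.factorial (n + 0)) * y ^ 0
      - ((n : ℝ) + 1) * ((-1 : ℝ) ^ 0 / (Nat.factorial 0 * Nat.factorial (n + 1 + 0)) * y ^ 0)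
      = 0 := by
    simp only [add_zero, Nat.factorial_succ n, Nat.factorial_zero]
    push_cast
    field_simp
    ring
  rw [h7] at h6
  simp only [besselClifford] at h6 ⊢
  linarith

lemma hasDerivAt_besselClifford (n : ℕ) (y : ℝ) :
    HasDerivAt (besselClifford n) (-besselClifford (n + 1) y) y := by
  set R : ℝ := |y| + 1
  have hy : y ∈ Metric.ball (0 : ℝ) R := by simp [R]
  have hsum : Summable fun k : ℕ ↦ 1 / (Nat.factorial k : ℝ) * (k * R ^ (k - 1)) := by
    rw [← summable_nat_add_iff 1]
    refine (Real.summable_pow_div_factorial R).congr fun k ↦ ?_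
    rw [Nat.factorial_succ]
    have p1 : (Nat.factorial k : ℝ) ≠ 0 := by positivity
    have p3 : (k : ℝ) + 1 ≠ 0 := by positivity
    push_cast
    field_simp
  have h := hasDerivAt_tsum_of_isPreconnected (𝕜 := ℝ) hsum Metric.isOpen_ball
    (convex_ball (0 : ℝ) R).isPreconnected
    (g := fun k y ↦ (-1 : ℝ) ^ k / (Nat.factorial k * Nat.factorial (n + k)) * y ^ k)
    (g' := fun k y ↦ (-1 : ℝ) ^ k / (Nat.factorial k * Nat.factorial (n + k)) * (k * y ^ (k - 1)))
    (fun k z _ ↦ (hasDerivAt_pow k z).const_mul _)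
    (fun k z hz ↦ by
      rw [norm_mul]
      refine mul_le_mul (norm_besselClifford_coeff_le n k) ?_ (norm_nonneg _) (by positivity)
      rw [norm_mul, norm_pow, Real.norm_natCast]
      have : ‖z‖ ≤ R := by simpa using (Metric.mem_ball.1 hz).le
      gcongr)
    hy (summable_besselClifford n y) hy
  refine HasDerivAt.congr_deriv (f := besselClifford n) h ?_
  have hs : Summable fun k : ℕ ↦
      (-1 : ℝ) ^ k / (Nat.factorial k * Nat.factorial (n + k)) * (k * y ^ (k - 1)) := by
    refine Summable.of_norm_bounded hsum fun k ↦ ?_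
    rw [norm_mul]
    refine mul_le_mul (norm_besselClifford_coeff_le n k) ?_ (norm_nonneg _) (by positivity)
    rw [norm_mul, norm_pow, Real.norm_natCast]
    have : ‖y‖ ≤ R := by simp [R]
    gcongr
  rw [hs.tsum_eq_zero_add]
  simp only [Nat.cast_zero, zero_mul, mul_zero, zero_add]
  rw [besselClifford, ← tsum_neg]
  refine tsum_congr fun k ↦ ?_
  have e1 : n + 1 + k = n + (k + 1) := by ring
  rw [e1, Nat.factorial_succ k]
  have p1 : (Nat.factorial k : ℝ) ≠ 0 := by positivity
  have p2 : (Nat.factorial (n + (k + 1)) : ℝ) ≠ 0 := by positivity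
  have p3 : (k : ℝ) + 1 ≠ 0 := by positivity
  push_cast
  field_simp
  ring

lemma hasDerivAt_besselClifford_sq (n : ℕ) (x : ℝ) :
    HasDerivAt (fun x ↦ besselClifford n (x ^ 2 / 4))
      (-besselClifford (n + 1) (x ^ 2 / 4) * (x / 2)) x := by
  have h1 : HasDerivAt (fun x : ℝ ↦ x ^ 2 / 4) (x / 2) x := by
    refine ((hasDerivAt_pow 2 x).div_const 4).congr_deriv ?_
    push_cast
    ring
  exact (hasDerivAt_besselClifford n (x ^ 2 / 4)).comp x h1

lemma hasDerivAt_besselJ_zero (x : ℝ) : HasDerivAt (besselJ 0) (-besselJ 1 x) x := by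
  have h := hasDerivAt_besselClifford_sq 0 x
  have e : besselJ 0 = fun x ↦ besselClifford 0 (x ^ 2 / 4) := by
    funext x
    simp [besselJ_eq_besselClifford]
  rw [e, besselJ_eq_besselClifford]
  exact h.congr_deriv (by ring)

lemma hasDerivAt_besselJ_succ (n : ℕ) (x : ℝ) :
    HasDerivAt (besselJ (n + 1)) ((besselJ n x - besselJ (n + 2) x) / 2) x := by
  have h := hasDerivAt_besselClifford_sq (n + 1) x
  have e : besselJ (n + 1) = fun x ↦ (x / 2) ^ (n + 1) * besselClifford (n + 1) (x ^ 2 / 4) := by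
    funext x
    rw [besselJ_eq_besselClifford]
  have h1 : HasDerivAt (fun x : ℝ ↦ (x / 2) ^ (n + 1)) ((n + 1) * (x / 2) ^ n * (1 / 2)) x := by
    refine (((hasDerivAt_id x).div_const 2).pow (n + 1)).congr_deriv ?_
    push_cast
    simp
  rw [e, besselJ_eq_besselClifford, besselJ_eq_besselClifford, besselClifford_recurrence n]
  exact (h1.mul h).congr_deriv (by ring)

lemma besselJ_recurrence (n : ℕ) (x : ℝ) :
    x * (besselJ n x + besselJ (n + 2) x) = 2 * (n + 1) * besselJ (n + 1) x := by
  rw [besselJ_eq_besselClifford, besselJ_eq_besselClifford, besselJ_eq_besselClifford,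
    besselClifford_recurrence n]
  ring

lemma continuous_besselJ (n : ℕ) : Continuous (besselJ n) := by
  rcases n with _ | n
  · exact continuous_iff_continuousAt.2 fun x ↦ (hasDerivAt_besselJ_zero x).continuousAt
  · exact continuous_iff_continuousAt.2 fun x ↦ (hasDerivAt_besselJ_succ n x).continuousAt

lemma besselJ_zero_zero : besselJ 0 0 = 1 := by
  rw [besselJ, tsum_eq_single 0]
  · simp
  · intro k hk
    simp [hk]

lemma besselJ_succ_zero (n : ℕ) : besselJ (n + 1) 0 = 0 := by
  simp [besselJ_eq_besselClifford]

/-- Monotonicity of a modified energy bounds `x (J₀² + J₁²)`. -/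
lemma exists_besselJ_zero_one_sq_le :
    ∃ C : ℝ, 0 ≤ C ∧ ∀ x : ℝ, 1 ≤ x → besselJ 0 x ^ 2 + besselJ 1 x ^ 2 ≤ C / x := by
  set F : ℝ → ℝ := fun x ↦ x * (besselJ 0 x ^ 2 + besselJ 1 x ^ 2) - besselJ 0 x * besselJ 1 x
    with hF
  have hF' : ∀ x : ℝ, 1 ≤ x → HasDerivAt F (besselJ 0 x * besselJ 1 x / x) x := by
    intro x hx
    have hx0 : x ≠ 0 := by linarith
    have h0 := hasDerivAt_besselJ_zero x
    have h1 := hasDerivAt_besselJ_succ 0 x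
    have hr := besselJ_recurrence 0 x
    simp only [zero_add] at h1 hr
    have h2 : besselJ 2 x = 2 * besselJ 1 x / x - besselJ 0 x := by
      field_simp
      push_cast at hr
      linarith
    refine (((hasDerivAt_id x).mul ((h0.pow 2).add (h1.pow 2))).sub (h0.mul h1)).congr_deriv ?_
    rw [h2]
    simp only [Pi.add_apply, Pi.pow_apply, id]
    push_cast
    field_simp
    ring
  have hlow : ∀ x : ℝ, 1 ≤ x → x / 2 * (besselJ 0 x ^ 2 + besselJ 1 x ^ 2) ≤ F x := by
    intro x hx
    simp only [hF]
    nlinarith [sq_nonneg (besselJ 0 x - besselJ 1 x), sq_nonneg (besselJ 0 x),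
      sq_nonneg (besselJ 1 x)]
  have hanti : AntitoneOn (fun x ↦ F x * Real.exp (1 / x)) (Set.Ici 1) := by
    have hd : ∀ x : ℝ, 1 ≤ x → HasDerivAt (fun x ↦ F x * Real.exp (1 / x))
        (besselJ 0 x * besselJ 1 x / x * Real.exp (1 / x)
          + F x * (Real.exp (1 / x) * (-1 / x ^ 2))) x := by
      intro x hx
      have hx0 : x ≠ 0 := by linarith
      have : HasDerivAt (fun x : ℝ ↦ 1 / x) (-1 / x ^ 2) x := by
        simpa [one_div, neg_div] using hasDerivAt_inv hx0
      exact (hF' x hx).mul this.exp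
    refine antitoneOn_of_deriv_nonpos (convex_Ici 1)
      (fun x hx ↦ (hd x hx).continuousAt.continuousWithinAt)
      (fun x hx ↦ (hd x (interior_subset hx)).differentiableAt.differentiableWithinAt) ?_
    intro x hx
    have hx1 : 1 ≤ x := interior_subset hx
    have hx0 : 0 < x := by linarith
    rw [(hd x hx1).deriv]
    have hl := hlow x hx1
    have : besselJ 0 x * besselJ 1 x / x - F x / x ^ 2 ≤ 0 := by
      rw [div_sub_div _ _ hx0.ne' (by positivity)]
      apply div_nonpos_of_nonpos_of_nonneg _ (by positivity)
      nlinarith [sq_nonneg (besselJ 0 x - besselJ 1 x),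
        mul_le_mul_of_nonneg_left hl hx0.le, mul_nonneg (sq_nonneg x)
          (sq_nonneg (besselJ 0 x - besselJ 1 x))]
    calc _ = (besselJ 0 x * besselJ 1 x / x - F x / x ^ 2) * Real.exp (1 / x) := by ring
      _ ≤ 0 := mul_nonpos_of_nonpos_of_nonneg this (Real.exp_pos _).le
  have hF1 : 0 ≤ F 1 := le_trans (by positivity) (hlow 1 le_rfl)
  refine ⟨2 * (F 1 * Real.exp (1 / 1)), by positivity, fun x hx ↦ ?_⟩
  have hx0 : 0 < x := by linarith
  have h1 := hanti (Set.mem_Ici.2 le_rfl) (Set.mem_Ici.2 hx) hx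
  have h2 := hlow x hx
  have hFx : 0 ≤ F x := le_trans (by positivity) h2
  have h3 : F x ≤ F x * Real.exp (1 / x) :=
    le_mul_of_one_le_right hFx (Real.one_le_exp (by positivity))
  rw [le_div_iff₀ hx0]
  simp only at h1
  linarith

/-- `J_n(x) = O(x^{-1/2})`. -/
lemma exists_abs_besselJ_le (n : ℕ) :
    ∃ C : ℝ, 0 ≤ C ∧ ∀ x : ℝ, 0 ≤ x → |besselJ n x| ≤ C * (1 + x) ^ (-(1 / 2) : ℝ) := by
  have hcompact : ∀ n, ∃ C : ℝ, 0 ≤ C ∧ ∀ x ∈ Set.Icc (0 : ℝ) 1, |besselJ n x| ≤ C := by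
    intro n
    obtain ⟨C, hC⟩ := isCompact_Icc.exists_bound_of_continuousOn
      ((continuous_besselJ n).continuousOn (s := Set.Icc (0 : ℝ) 1))
    exact ⟨C, le_trans (norm_nonneg _) (hC 0 (by simp)), hC⟩
  have hlarge : ∀ n, ∃ C : ℝ, 0 ≤ C ∧ ∀ x : ℝ, 1 ≤ x → |besselJ n x| ≤ C / √x := by
    obtain ⟨C, hC0, hC⟩ := exists_besselJ_zero_one_sq_le
    have key : ∀ y x : ℝ, 1 ≤ x → y ^ 2 ≤ C / x → |y| ≤ √C / √x := by
      intro y x hx h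
      rw [← Real.sqrt_div hC0]
      exact Real.abs_le_sqrt h
    have h0 : ∀ x : ℝ, 1 ≤ x → |besselJ 0 x| ≤ √C / √x := fun x hx ↦
      key _ x hx (by nlinarith [hC x hx, sq_nonneg (besselJ 1 x)])
    have h1 : ∀ x : ℝ, 1 ≤ x → |besselJ 1 x| ≤ √C / √x := fun x hx ↦
      key _ x hx (by nlinarith [hC x hx, sq_nonneg (besselJ 0 x)])
    intro n
    induction n using Nat.twoStepInduction with
    | zero => exact ⟨√C, by positivity, h0⟩
    | one => exact ⟨√C, by positivity, h1⟩
    | more n ih0 ih1 =>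
      obtain ⟨A, hA0, hA⟩ := ih0
      obtain ⟨B, hB0, hB⟩ := ih1
      refine ⟨2 * (n + 1) * B + A, by positivity, fun x hx ↦ ?_⟩
      have hx0 : 0 < x := by linarith
      have hr := besselJ_recurrence n x
      have e : besselJ (n + 2) x = 2 * (n + 1) * besselJ (n + 1) x / x - besselJ n x := by
        field_simp
        linarith
      rw [e]
      refine (abs_sub _ _).trans ?_
      rw [add_div]
      refine add_le_add ?_ (hA x hx)
      rw [abs_div, abs_mul, abs_of_pos hx0, abs_of_nonneg (by positivity : (0 : ℝ) ≤ 2 * (n + 1)),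
        mul_div_assoc (2 * ((n : ℝ) + 1)) B]
      refine (div_le_self (by positivity) hx).trans ?_
      exact mul_le_mul_of_nonneg_left (hB x hx) (by positivity)
  obtain ⟨A, hA0, hA⟩ := hcompact n
  obtain ⟨B, hB0, hB⟩ := hlarge n
  refine ⟨√2 * (A + B), by positivity, fun x hx ↦ ?_⟩
  have e : (1 + x) ^ (-(1 / 2) : ℝ) = 1 / √(1 + x) := by
    rw [Real.rpow_neg (by linarith), Real.sqrt_eq_rpow, one_div ((1 + x) ^ _)]
  rw [e, mul_one_div, le_div_iff₀ (by positivity)]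
  rcases le_total x 1 with h | h
  · have h2 : √(1 + x) ≤ √2 := Real.sqrt_le_sqrt (by linarith)
    calc |besselJ n x| * √(1 + x) ≤ A * √2 :=
          mul_le_mul (hA x ⟨hx, h⟩) h2 (by positivity) hA0
      _ ≤ _ := by nlinarith [Real.sqrt_nonneg 2]
  · have h2 : √(1 + x) ≤ √2 * √x := by
      rw [← Real.sqrt_mul (by norm_num)]
      exact Real.sqrt_le_sqrt (by linarith)
    have hx0 : 0 < √x := by positivity
    calc |besselJ n x| * √(1 + x) ≤ B / √x * (√2 * √x) :=
          mul_le_mul (hB x h) h2 (by positivity) (by positivity)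
      _ = B * √2 := by field_simp
      _ ≤ _ := by nlinarith [Real.sqrt_nonneg 2]

lemma exists_norm_besselJ_le (n : ℕ) :
    ∃ C : ℝ, 0 ≤ C ∧ ∀ x : ℝ, 0 ≤ x → ‖besselJ n x‖ ≤ C := by
  obtain ⟨C, hC0, hC⟩ := exists_abs_besselJ_le n
  refine ⟨C, hC0, fun x hx ↦ (hC x hx).trans (mul_le_of_le_one_right hC0 ?_)⟩
  exact Real.rpow_le_one_of_one_le_of_nonpos (by linarith) (by norm_num)

/-- Bessel's integral for `J₀`. -/
lemma integral_cos_mul_sin (x : ℝ) :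
    ∫ θ in (-(π / 2))..(π / 2), Real.cos (x * Real.sin θ) = π * besselJ 0 x := by
  have hper : Function.Periodic (fun θ ↦ Real.cos (x * Real.sin θ)) π := by
    intro θ
    simp [Real.sin_add_pi]
  have h1 := hper.intervalIntegral_add_eq (-(π / 2)) 0
  rw [show -(π / 2) + π = π / 2 by ring, zero_add] at h1
  rw [h1]
  have h2 : HasSum (fun k : ℕ ↦ ∫ θ in (0 : ℝ)..π,
      (-1 : ℝ) ^ k * (x * Real.sin θ) ^ (2 * k) / (Nat.factorial (2 * k) : ℝ))
      (∫ θ in (0 : ℝ)..π, Real.cos (x * Real.sin θ)) := by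
    refine intervalIntegral.hasSum_integral_of_dominated_convergence
      (fun k _ ↦ |x| ^ (2 * k) / (Nat.factorial (2 * k) : ℝ)) (fun k ↦ ?_) (fun k ↦ ?_) ?_ ?_ ?_
    · exact (by fun_prop : Continuous _).aestronglyMeasurable
    · refine Filter.Eventually.of_forall fun θ _ ↦ ?_
      rw [norm_div, norm_mul, norm_pow, norm_neg, norm_one, one_pow, one_mul, norm_pow, norm_mul,
        Real.norm_natCast, Real.norm_eq_abs, Real.norm_eq_abs]
      gcongr
      exact mul_le_of_le_one_right (abs_nonneg _) (Real.abs_sin_le_one θ)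
    · refine Filter.Eventually.of_forall fun θ _ ↦ ?_
      exact (Real.summable_pow_div_factorial |x|).comp_injective
        (mul_right_injective₀ (two_ne_zero (α := ℕ)))
    · exact intervalIntegrable_const
    · exact Filter.Eventually.of_forall fun θ _ ↦ Real.hasSum_cos _
  rw [← h2.tsum_eq, besselJ, ← tsum_mul_left]
  refine tsum_congr fun k ↦ ?_
  have h3 : ∀ θ : ℝ, (-1 : ℝ) ^ k * (x * Real.sin θ) ^ (2 * k) / (Nat.factorial (2 * k) : ℝ)
      = (-1 : ℝ) ^ k * x ^ (2 * k) / (Nat.factorial (2 * k) : ℝ) * Real.sin θ ^ (2 * k) := by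
    intro θ
    ring
  simp_rw [h3]
  rw [intervalIntegral.integral_const_mul, integral_sin_pow_even]
  have h4 : ∀ k : ℕ, (∏ i ∈ Finset.range k, (2 * (i : ℝ) + 1) / (2 * i + 2))
      = (Nat.factorial (2 * k) : ℝ) / ((Nat.factorial k : ℝ) ^ 2 * 2 ^ (2 * k)) := by
    intro k
    induction k with
    | zero => simp
    | succ k ih =>
      rw [Finset.prod_range_succ, ih, show 2 * (k + 1) = 2 * k + 1 + 1 by ring,
        Nat.factorial_succ (2 * k + 1), Nat.factorial_succ (2 * k), Nat.factorial_succ k]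
      have p1 : (Nat.factorial k : ℝ) ≠ 0 := by positivity
      push_cast
      field_simp
      ring
  rw [h4]
  have p1 : (Nat.factorial k : ℝ) ≠ 0 := by positivity
  have p2 : (Nat.factorial (2 * k) : ℝ) ≠ 0 := by positivity
  simp only [zero_add, div_pow]
  field_simp

/-! ### Integrals against `J₀` -/

/-- The integral of `exp (i y sin τ)` along the segment from `-π/2 + iT` to `π/2 + iT`. -/
noncomputable def shiftedBesselIntegral (T y : ℝ) : ℂ :=
  ∫ θ in (-(π / 2))..(π / 2), Complex.exp (Complex.I * (y * Complex.sin (θ + T * Complex.I)))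

lemma re_intervalIntegral_eq {f : ℝ → ℂ} (hf : Continuous f) (a b : ℝ) :
    (∫ x in a..b, f x).re = ∫ x in a..b, (f x).re :=
  (Complex.reCLM.intervalIntegral_comp_comm (hf.intervalIntegrable a b)).symm

lemma im_intervalIntegral_eq {f : ℝ → ℂ} (hf : Continuous f) (a b : ℝ) :
    (∫ x in a..b, f x).im = ∫ x in a..b, (f x).im :=
  (Complex.imCLM.intervalIntegral_comp_comm (hf.intervalIntegrable a b)).symm

lemma pi_mul_besselJ_zero_eq (T y : ℝ) :
    π * besselJ 0 y
      = 2 * (∫ t in (0 : ℝ)..T, Real.sin (y * Real.cosh t)) + (shiftedBesselIntegral T y).re := by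
  have hrect := Complex.integral_boundary_rect_eq_zero_of_differentiableOn
    (fun τ : ℂ ↦ Complex.exp (Complex.I * (y * Complex.sin τ)))
    (⟨-(π / 2), 0⟩ : ℂ) (⟨π / 2, T⟩ : ℂ) (by fun_prop)
  simp only [Complex.ofReal_zero, zero_mul, add_zero] at hrect
  have hre := congrArg Complex.re hrect
  have hb : (∫ x in (-(π / 2))..(π / 2),
      Complex.exp (Complex.I * (y * Complex.sin (x : ℂ)))).re = π * besselJ 0 y := by
    rw [re_intervalIntegral_eq (by fun_prop), ← integral_cos_mul_sin]
    congr 1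
    funext θ
    rw [Complex.exp_re, ← Complex.ofReal_sin, ← Complex.ofReal_mul]
    simp [-Complex.ofReal_sin]
  have hr : (∫ t in (0 : ℝ)..T, Complex.exp (Complex.I * (y * Complex.sin
      (((π / 2 : ℝ) : ℂ) + t * Complex.I)))).im
        = ∫ t in (0 : ℝ)..T, Real.sin (y * Real.cosh t) := by
    rw [im_intervalIntegral_eq (by fun_prop)]
    congr 1
    funext t
    have e : Complex.sin (((π / 2 : ℝ) : ℂ) + t * Complex.I) = (Real.cosh t : ℂ) := by
      push_cast
      rw [add_comm, Complex.sin_add_pi_div_two, Complex.cos_mul_I]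
    rw [e, Complex.exp_im, ← Complex.ofReal_mul]
    simp
  have hl : (∫ t in (0 : ℝ)..T, Complex.exp (Complex.I * (y * Complex.sin
      (((-(π / 2) : ℝ) : ℂ) + t * Complex.I)))).im
        = -∫ t in (0 : ℝ)..T, Real.sin (y * Real.cosh t) := by
    rw [im_intervalIntegral_eq (by fun_prop), ← intervalIntegral.integral_neg]
    congr 1
    funext t
    have e : Complex.sin (((-(π / 2) : ℝ) : ℂ) + t * Complex.I) = ((-Real.cosh t : ℝ) : ℂ) := by
      push_cast
      rw [add_comm, ← sub_eq_add_neg, Complex.sin_sub_pi_div_two, Complex.cos_mul_I]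
    rw [e, Complex.exp_im, ← Complex.ofReal_mul]
    simp
  simp only [Complex.add_re, Complex.sub_re, Complex.zero_re, smul_eq_mul, Complex.mul_re,
    Complex.I_re, Complex.I_im, zero_mul, one_mul, zero_sub] at hre
  rw [hb, hr, hl] at hre
  change π * besselJ 0 y - (shiftedBesselIntegral T y).re + _ - _ = 0 at hre
  linarith

lemma norm_exp_I_mul_sin (T y θ : ℝ) :
    ‖Complex.exp (Complex.I * (y * Complex.sin (θ + T * Complex.I)))‖
      = Real.exp (-(y * Real.cos θ * Real.sinh T)) := by
  rw [Complex.norm_exp, Complex.sin_add_mul_I, ← Complex.ofReal_sin, ← Complex.ofReal_cos,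
    ← Complex.ofReal_sinh, ← Complex.ofReal_cosh]
  congr 1
  simp [-Complex.ofReal_sin, -Complex.ofReal_cos, -Complex.ofReal_sinh, -Complex.ofReal_cosh]
  ring

lemma cos_nonneg_of_mem_uIoc {θ : ℝ} (hθ : θ ∈ Set.uIoc (-(π / 2)) (π / 2)) : 0 ≤ Real.cos θ := by
  rw [Set.uIoc_of_le (by linarith [Real.pi_pos])] at hθ
  exact Real.cos_nonneg_of_mem_Icc ⟨hθ.1.le, hθ.2⟩

lemma norm_exp_I_mul_sin_le {T y θ : ℝ} (hT : 0 ≤ T) (hy : 0 ≤ y)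
    (hθ : θ ∈ Set.uIoc (-(π / 2)) (π / 2)) :
    ‖Complex.exp (Complex.I * (y * Complex.sin (θ + T * Complex.I)))‖ ≤ 1 := by
  rw [norm_exp_I_mul_sin, Real.exp_le_one_iff, neg_nonpos]
  exact mul_nonneg (mul_nonneg hy (cos_nonneg_of_mem_uIoc hθ)) (Real.sinh_nonneg_iff.2 hT)

lemma norm_shiftedBesselIntegral_le {T y : ℝ} (hT : 0 ≤ T) (hy : 0 ≤ y) :
    ‖shiftedBesselIntegral T y‖ ≤ π := by
  have h := intervalIntegral.norm_integral_le_of_norm_le_const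
    (fun θ hθ ↦ norm_exp_I_mul_sin_le hT hy hθ)
  have e : 1 * |π / 2 - -(π / 2)| = π := by
    rw [one_mul, abs_of_pos (by linarith [Real.pi_pos])]
    ring
  exact h.trans e.le

lemma tendsto_shiftedBesselIntegral {y : ℝ} (hy : 0 < y) :
    Filter.Tendsto (fun T ↦ shiftedBesselIntegral T y) Filter.atTop (nhds 0) := by
  have h := intervalIntegral.tendsto_integral_filter_of_dominated_convergence
    (μ := volume) (a := -(π / 2)) (b := π / 2) (l := Filter.atTop)
    (F := fun (T : ℝ) (θ : ℝ) ↦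
      Complex.exp (Complex.I * (y * Complex.sin (θ + T * Complex.I))))
    (f := fun _ ↦ 0) (fun _ ↦ 1)
    (Filter.Eventually.of_forall fun T ↦ (by fun_prop : Continuous _).aestronglyMeasurable)
    (by
      filter_upwards [Filter.eventually_ge_atTop 0] with T hT
      exact Filter.Eventually.of_forall fun θ hθ ↦ norm_exp_I_mul_sin_le hT hy.le hθ)
    intervalIntegrable_const
    (by
      have hne : ∀ᵐ θ : ℝ, θ ≠ π / 2 := by simp [ae_iff]
      filter_upwards [hne] with θ hθne hθ
      rw [Set.uIoc_of_le (by linarith [Real.pi_pos])] at hθ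
      have hc : 0 < Real.cos θ :=
        Real.cos_pos_of_mem_Ioo ⟨hθ.1, lt_of_le_of_ne hθ.2 hθne⟩
      rw [tendsto_zero_iff_norm_tendsto_zero]
      simp_rw [norm_exp_I_mul_sin]
      refine Real.tendsto_exp_neg_atTop_nhds_zero.comp ?_
      refine Filter.Tendsto.const_mul_atTop (by positivity) ?_
      refine Filter.tendsto_atTop_mono' _ ?_ Filter.tendsto_id
      filter_upwards [Filter.eventually_ge_atTop 0] with T hT
      exact Real.self_le_sinh_iff.2 hT)
  simpa [shiftedBesselIntegral] using h

/-- If the sine transform of `h` vanishes on `[lam, ∞)`, then `h` is orthogonal to `J₀(lam x)`. -/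
lemma integral_mul_besselJ_zero_eq_zero {h : ℝ → ℂ} (hh : IntegrableOn h (Set.Ioi 0)) {lam : ℝ}
    (hlam : 0 < lam)
    (hsin : ∀ u, lam ≤ u → ∫ x in Set.Ioi (0 : ℝ), h x * (Real.sin (u * x) : ℂ) = 0) :
    ∫ x in Set.Ioi (0 : ℝ), h x * (besselJ 0 (lam * x) : ℂ) = 0 := by
  have hcJ : Continuous fun x : ℝ ↦ (besselJ 0 (lam * x) : ℂ) :=
    Complex.continuous_ofReal.comp
      ((continuous_besselJ 0).comp (continuous_const.mul continuous_id))
  have hJint : IntegrableOn (fun x ↦ h x * (besselJ 0 (lam * x) : ℂ)) (Set.Ioi 0) := by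
    obtain ⟨C, hC0, hC⟩ := exists_norm_besselJ_le 0
    refine Integrable.mul_bdd (c := C) hh hcJ.aestronglyMeasurable ?_
    filter_upwards [ae_restrict_mem measurableSet_Ioi] with x hx
    rw [Complex.norm_real]
    exact hC _ (mul_nonneg hlam.le (le_of_lt hx))
  have hswap : ∀ T, 0 ≤ T → ∫ x in Set.Ioi (0 : ℝ),
      h x * ((∫ t in (0 : ℝ)..T, Real.sin (lam * x * Real.cosh t) : ℝ) : ℂ) = 0 := by
    intro T hT
    have hprod : Integrable (Function.uncurry fun (t : ℝ) (x : ℝ) ↦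
        h x * (Real.sin (lam * x * Real.cosh t) : ℂ))
        ((volume.restrict (Set.uIoc 0 T)).prod (volume.restrict (Set.Ioi 0))) := by
      have h1 : Integrable (fun z : ℝ × ℝ ↦ (1 : ℂ) * h z.2)
          ((volume.restrict (Set.uIoc 0 T)).prod (volume.restrict (Set.Ioi 0))) :=
        Integrable.mul_prod (f := fun _ : ℝ ↦ (1 : ℂ)) (by
          rw [← IntegrableOn, ← intervalIntegrable_iff]
          exact intervalIntegrable_const) hh
      simp only [one_mul] at h1
      refine Integrable.mul_bdd (c := 1) h1 ?_ ?_
      · exact (by fun_prop : Continuous fun z : ℝ × ℝ ↦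
          (Real.sin (lam * z.2 * Real.cosh z.1) : ℂ)).aestronglyMeasurable
      · refine Filter.Eventually.of_forall fun z ↦ ?_
        rw [Complex.norm_real]
        exact Real.abs_sin_le_one _
    have e := intervalIntegral_integral_swap hprod
    have e1 : ∀ x : ℝ, h x * ((∫ t in (0 : ℝ)..T, Real.sin (lam * x * Real.cosh t) : ℝ) : ℂ)
        = ∫ t in (0 : ℝ)..T, h x * (Real.sin (lam * x * Real.cosh t) : ℂ) := by
      intro x
      rw [intervalIntegral.integral_const_mul, intervalIntegral.integral_ofReal]
    simp_rw [e1]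
    rw [← e]
    have e2 : ∀ t : ℝ,
        ∫ x in Set.Ioi (0 : ℝ), h x * (Real.sin (lam * x * Real.cosh t) : ℂ) = 0 := by
      intro t
      have := hsin (lam * Real.cosh t) (le_mul_of_one_le_right hlam.le (Real.one_le_cosh t))
      rw [← this]
      congr 1
      funext x
      congr 3
      ring
    simp_rw [e2]
    simp
  have hrem : ∀ T, 0 ≤ T → ∫ x in Set.Ioi (0 : ℝ),
      h x * (((shiftedBesselIntegral T (lam * x)).re : ℝ) : ℂ)
        = π * ∫ x in Set.Ioi (0 : ℝ), h x * (besselJ 0 (lam * x) : ℂ) := by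
    intro T hT
    have e : ∀ x, h x * (((shiftedBesselIntegral T (lam * x)).re : ℝ) : ℂ)
        = π * (h x * (besselJ 0 (lam * x) : ℂ))
          - 2 * (h x * ((∫ t in (0 : ℝ)..T, Real.sin (lam * x * Real.cosh t) : ℝ) : ℂ)) := by
      intro x
      have := pi_mul_besselJ_zero_eq T (lam * x)
      have e' : (shiftedBesselIntegral T (lam * x)).re = π * besselJ 0 (lam * x)
        - 2 * (∫ t in (0 : ℝ)..T, Real.sin (lam * x * Real.cosh t)) := by linarith
      rw [e']
      push_cast
      ring
    simp_rw [e]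
    rw [integral_sub (hJint.const_mul _), integral_const_mul, integral_const_mul, hswap T hT,
      mul_zero, sub_zero]
    refine Integrable.const_mul ?_ _
    refine Integrable.mul_bdd (c := T) hh ?_ ?_
    · refine (Complex.continuous_ofReal.comp ?_).aestronglyMeasurable
      exact intervalIntegral.continuous_parametric_intervalIntegral_of_continuous'
        (by fun_prop) 0 T
    · refine Filter.Eventually.of_forall fun x ↦ ?_
      rw [Complex.norm_real]
      refine (intervalIntegral.norm_integral_le_of_norm_le_const (C := 1)
        fun t _ ↦ Real.abs_sin_le_one _).trans ?_
      rw [one_mul, sub_zero, abs_of_nonneg hT]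
  have hlim : Filter.Tendsto (fun T ↦ ∫ x in Set.Ioi (0 : ℝ),
      h x * (((shiftedBesselIntegral T (lam * x)).re : ℝ) : ℂ)) Filter.atTop
      (nhds (∫ _ in Set.Ioi (0 : ℝ), (0 : ℂ))) := by
    refine tendsto_integral_filter_of_dominated_convergence (fun x ↦ ‖h x‖ * π) ?_ ?_
      (hh.norm.mul_const _) ?_
    · filter_upwards [] with T
      refine hh.aestronglyMeasurable.mul
        (Complex.continuous_ofReal.comp (Complex.continuous_re.comp ?_)).aestronglyMeasurable
      exact intervalIntegral.continuous_parametric_intervalIntegral_of_continuous'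
        (by fun_prop) _ _
    · filter_upwards [Filter.eventually_ge_atTop 0] with T hT
      filter_upwards [ae_restrict_mem measurableSet_Ioi] with x hx
      rw [norm_mul, Complex.norm_real]
      refine mul_le_mul_of_nonneg_left ((Complex.abs_re_le_norm _).trans ?_) (norm_nonneg _)
      exact norm_shiftedBesselIntegral_le hT (mul_nonneg hlam.le (le_of_lt hx))
    · filter_upwards [ae_restrict_mem measurableSet_Ioi] with x hx
      have h1 := tendsto_shiftedBesselIntegral (mul_pos hlam hx)
      have h2 := (Complex.continuous_ofReal.comp Complex.continuous_re).tendsto 0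
      have h3 := (h2.comp h1).const_mul (h x)
      simpa using h3
  rw [integral_zero] at hlim
  have hconst : Filter.Tendsto (fun T : ℝ ↦ ∫ x in Set.Ioi (0 : ℝ),
      h x * (((shiftedBesselIntegral T (lam * x)).re : ℝ) : ℂ)) Filter.atTop
      (nhds (π * ∫ x in Set.Ioi (0 : ℝ), h x * (besselJ 0 (lam * x) : ℂ))) := by
    refine tendsto_const_nhds.congr' ?_
    filter_upwards [Filter.eventually_ge_atTop 0] with T hT
    exact (hrem T hT).symm
  have := tendsto_nhds_unique hconst hlim
  simpa [Real.pi_ne_zero] using this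

/-! ### Entire functions of exponential type -/

/-- Entire functions of exponential type `L` with quadratic decay along horizontal lines. -/
structure IsPaleyWiener (L : ℝ) (f : ℂ → ℂ) : Prop where
  differentiable : Differentiable ℂ f
  bound : ∃ C : ℝ, ∀ z : ℂ, ‖f z‖ ≤ C * Real.exp (L * |z.im|) / (1 + ‖z‖) ^ 2

lemma integrable_one_add_abs_sq_inv (C : ℝ) :
    Integrable fun x : ℝ ↦ C / (1 + |x|) ^ 2 := by
  have h : Integrable (fun x : ℝ ↦ (1 + ‖x‖) ^ (-(2 : ℝ))) :=
    integrable_one_add_norm (by simp)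
  refine (h.const_mul C).congr (Filter.Eventually.of_forall fun x ↦ ?_)
  have : (1 + ‖x‖) ^ (-(2 : ℝ)) = ((1 + |x|) ^ 2)⁻¹ := by
    rw [Real.rpow_neg (by positivity), Real.norm_eq_abs]
    norm_cast
  simp only [this, div_eq_mul_inv]

namespace IsPaleyWiener

variable {L : ℝ} {f : ℂ → ℂ}

lemma deriv (hf : IsPaleyWiener L f) (hL : 0 ≤ L) : IsPaleyWiener L (deriv f) := by
  obtain ⟨C, hC⟩ := hf.bound
  have hC0 : 0 ≤ C := by
    have := (norm_nonneg _).trans (hC 0)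
    simpa using this
  refine ⟨hf.differentiable.deriv, C * Real.exp L * 4, fun z ↦ ?_⟩
  have h := Complex.norm_deriv_le_of_forall_mem_sphere_norm_le (c := z) (R := 1) (f := f)
    (C := C * Real.exp L * 4 * Real.exp (L * |z.im|) / (1 + ‖z‖) ^ 2) one_pos
    hf.differentiable.diffContOnCl ?_
  · simpa using h
  intro w hw
  refine (hC w).trans ?_
  have hwz : ‖w - z‖ = 1 := by simpa [dist_eq_norm] using hw
  have him : |w.im| ≤ |z.im| + 1 := by
    have h1 : |(w - z).im| ≤ 1 := hwz ▸ Complex.abs_im_le_norm (w - z)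
    have h2 : w.im = z.im + (w - z).im := by simp
    rw [h2]
    exact (abs_add_le _ _).trans (by linarith)
  have hn : ‖z‖ ≤ ‖w‖ + 1 := by
    have := norm_sub_norm_le z w
    rw [norm_sub_rev, hwz] at this
    linarith
  have he : Real.exp (L * |w.im|) ≤ Real.exp L * Real.exp (L * |z.im|) := by
    rw [← Real.exp_add]
    apply Real.exp_le_exp.2
    nlinarith
  rw [div_le_div_iff₀ (by positivity) (by positivity)]
  have h4 : (1 + ‖z‖) ^ 2 ≤ 4 * (1 + ‖w‖) ^ 2 := by nlinarith [norm_nonneg w, norm_nonneg z]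
  calc C * Real.exp (L * |w.im|) * (1 + ‖z‖) ^ 2
      ≤ C * (Real.exp L * Real.exp (L * |z.im|)) * (4 * (1 + ‖w‖) ^ 2) := by gcongr
    _ = _ := by ring

lemma exists_norm_horizontal_le (hf : IsPaleyWiener L f) :
    ∃ C : ℝ, 0 ≤ C ∧ ∀ x y : ℝ,
      ‖f (x + y * Complex.I)‖ ≤ C * Real.exp (L * |y|) / (1 + |x|) ^ 2 := by
  obtain ⟨C, hC⟩ := hf.bound
  have hC0 : 0 ≤ C := by
    have := (norm_nonneg _).trans (hC 0)
    simpa using this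
  refine ⟨C, hC0, fun x y ↦ (hC _).trans ?_⟩
  have h1 : |x| ≤ ‖(x + y * Complex.I : ℂ)‖ := by
    simpa using Complex.abs_re_le_norm (x + y * Complex.I : ℂ)
  have h2 : (x + y * Complex.I : ℂ).im = y := by simp
  rw [h2]
  gcongr

lemma continuous_ofReal (hf : IsPaleyWiener L f) : Continuous fun x : ℝ ↦ f x :=
  hf.differentiable.continuous.comp Complex.continuous_ofReal

lemma integrable (hf : IsPaleyWiener L f) : Integrable fun x : ℝ ↦ f x := by
  obtain ⟨C, hC0, hC⟩ := hf.exists_norm_horizontal_le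
  refine (integrable_one_add_abs_sq_inv C).mono' hf.continuous_ofReal.aestronglyMeasurable ?_
  refine Filter.Eventually.of_forall fun x ↦ ?_
  simpa using hC x 0

lemma tendsto_one_add_abs_sq_inv (C : ℝ) :
    Filter.Tendsto (fun x : ℝ ↦ C / (1 + |x|) ^ 2) Filter.atTop (nhds 0) := by
  refine Filter.Tendsto.div_atTop tendsto_const_nhds ?_
  refine (Filter.tendsto_pow_atTop two_ne_zero).comp ?_
  exact Filter.tendsto_atTop_add_const_left _ _ Filter.tendsto_abs_atTop_atTop

lemma tendsto_ofReal_atTop (hf : IsPaleyWiener L f) :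
    Filter.Tendsto (fun x : ℝ ↦ f x) Filter.atTop (nhds 0) := by
  obtain ⟨C, hC0, hC⟩ := hf.exists_norm_horizontal_le
  refine squeeze_zero_norm (fun x ↦ ?_) (tendsto_one_add_abs_sq_inv C)
  simpa using hC x 0

/-- The Fourier transform vanishes beyond the exponential type. -/
lemma integral_mul_exp_eq_zero (hf : IsPaleyWiener L f) {u : ℝ} (hu : L < u) :
    ∫ x : ℝ, f x * Complex.exp (Complex.I * (u * x)) = 0 := by
  obtain ⟨C, hC0, hC⟩ := hf.exists_norm_horizontal_le
  set F : ℂ → ℂ := fun z ↦ f z * Complex.exp (Complex.I * (u * z)) with hF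
  have hFd : Differentiable ℂ F := by
    have := hf.differentiable
    fun_prop
  have hFn : ∀ x y : ℝ, 0 ≤ y →
      ‖F (x + y * Complex.I)‖ ≤ C * Real.exp (-((u - L) * y)) / (1 + |x|) ^ 2 := by
    intro x y hy
    have h1 : ‖Complex.exp (Complex.I * (u * (x + y * Complex.I)))‖ = Real.exp (-(u * y)) := by
      rw [Complex.norm_exp]
      congr 1
      simp
    rw [hF, norm_mul, h1]
    calc _ ≤ C * Real.exp (L * |y|) / (1 + |x|) ^ 2 * Real.exp (-(u * y)) := by
          gcongr
          exact hC x y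
      _ = C * (Real.exp (L * |y|) * Real.exp (-(u * y))) / (1 + |x|) ^ 2 := by ring
      _ = _ := by
        rw [← Real.exp_add, abs_of_nonneg hy]
        ring_nf
  have hFn' : ∀ x y : ℝ, 0 ≤ y → ‖F (x + y * Complex.I)‖ ≤ C / (1 + |x|) ^ 2 := by
    intro x y hy
    refine (hFn x y hy).trans ?_
    gcongr
    refine mul_le_of_le_one_right hC0 (Real.exp_le_one_iff.2 ?_)
    have := mul_nonneg (sub_nonneg.2 hu.le) hy
    linarith
  have hFint : ∀ y : ℝ, 0 ≤ y → Integrable fun x : ℝ ↦ F (x + y * Complex.I) := by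
    intro y hy
    refine (integrable_one_add_abs_sq_inv C).mono' ?_
      (Filter.Eventually.of_forall fun x ↦ hFn' x y hy)
    exact (hFd.continuous.comp (by fun_prop)).aestronglyMeasurable
  have hshift : ∀ Y : ℝ, 0 ≤ Y →
      ∫ x : ℝ, F (x + (0 : ℝ) * Complex.I) = ∫ x : ℝ, F (x + Y * Complex.I) := by
    intro Y hY
    have hside : ∀ s : ℝ, (s = 1 ∨ s = -1) → Filter.Tendsto
        (fun T : ℝ ↦ Complex.I • ∫ y in (0 : ℝ)..Y, F (((s * T : ℝ) : ℂ) + y * Complex.I))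
        Filter.atTop (nhds 0) := by
      intro s hs
      have hlim := (tendsto_one_add_abs_sq_inv C).mul_const |Y - 0|
      rw [zero_mul] at hlim
      refine squeeze_zero_norm (fun T ↦ ?_) hlim
      rw [norm_smul, Complex.norm_I, one_mul]
      refine intervalIntegral.norm_integral_le_of_norm_le_const fun y hy ↦ ?_
      rw [Set.uIoc_of_le hY] at hy
      have habs : |s * T| = |T| := by rcases hs with rfl | rfl <;> simp
      rw [← habs]
      exact hFn' (s * T) y hy.1.le
    have hrect : ∀ T : ℝ, (∫ x in (-T)..T, F (x + (0 : ℝ) * Complex.I))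
        - (∫ x in (-T)..T, F (x + Y * Complex.I))
        + Complex.I • (∫ y in (0 : ℝ)..Y, F (((1 * T : ℝ) : ℂ) + y * Complex.I))
        - Complex.I • (∫ y in (0 : ℝ)..Y, F (((-1 * T : ℝ) : ℂ) + y * Complex.I)) = 0 := by
      intro T
      have := Complex.integral_boundary_rect_eq_zero_of_differentiableOn F
        (⟨-T, 0⟩ : ℂ) (⟨T, Y⟩ : ℂ) hFd.differentiableOn
      simpa using this
    have h0 := intervalIntegral_tendsto_integral (hFint 0 le_rfl)
      Filter.tendsto_neg_atTop_atBot Filter.tendsto_id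
    have h1 := intervalIntegral_tendsto_integral (hFint Y hY)
      Filter.tendsto_neg_atTop_atBot Filter.tendsto_id
    have h2 := ((h0.sub h1).add (hside 1 (Or.inl rfl))).sub (hside (-1) (Or.inr rfl))
    have h3 := h2.congr fun T ↦ hrect T
    have h4 := tendsto_nhds_unique h3 tendsto_const_nhds
    rw [add_zero, sub_zero] at h4
    exact sub_eq_zero.1 h4
  have hbound : ∀ Y : ℝ, 0 ≤ Y → ‖∫ x : ℝ, F (x + Y * Complex.I)‖
      ≤ (∫ x : ℝ, C / (1 + |x|) ^ 2) * Real.exp (-((u - L) * Y)) := by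
    intro Y hY
    rw [← integral_mul_const]
    refine norm_integral_le_of_norm_le ((integrable_one_add_abs_sq_inv C).mul_const _)
      (Filter.Eventually.of_forall fun x ↦ (hFn x Y hY).trans_eq ?_)
    ring
  have hlim : Filter.Tendsto (fun Y : ℝ ↦ ∫ x : ℝ, F (x + Y * Complex.I)) Filter.atTop
      (nhds 0) := by
    refine squeeze_zero_norm' (a := fun Y ↦
      (∫ x : ℝ, C / (1 + |x|) ^ 2) * Real.exp (-((u - L) * Y))) ?_ ?_
    · filter_upwards [Filter.eventually_ge_atTop 0] with Y hY using hbound Y hY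
    · have := (Real.tendsto_exp_neg_atTop_nhds_zero.comp
        (Filter.tendsto_id.const_mul_atTop (sub_pos.2 hu))).const_mul
          (∫ x : ℝ, C / (1 + |x|) ^ 2)
      simpa using this
  have hconst : Filter.Tendsto (fun Y : ℝ ↦ ∫ x : ℝ, F (x + Y * Complex.I)) Filter.atTop
      (nhds (∫ x : ℝ, F (x + (0 : ℝ) * Complex.I))) := by
    refine tendsto_const_nhds.congr' ?_
    filter_upwards [Filter.eventually_ge_atTop 0] with Y hY using hshift Y hY
  have := tendsto_nhds_unique hconst hlim
  simpa [hF] using this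

lemma integral_Ioi_mul_sin_eq_zero (hf : IsPaleyWiener L f) (hodd : ∀ z, f (-z) = -f z) {u : ℝ}
    (hu : L < u) : ∫ x in Set.Ioi (0 : ℝ), f x * (Real.sin (u * x) : ℂ) = 0 := by
  have h0 := hf.integral_mul_exp_eq_zero hu
  have hinteg : ∀ s : ℝ, Integrable fun x : ℝ ↦ f x * Complex.exp (Complex.I * (s * x)) := by
    intro s
    refine Integrable.mul_bdd (c := 1) hf.integrable
      (by fun_prop : Continuous _).aestronglyMeasurable ?_
    refine Filter.Eventually.of_forall fun x ↦ ?_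
    rw [Complex.norm_exp]
    simp
  rw [← intervalIntegral.integral_Iic_add_Ioi (b := 0) (hinteg u).integrableOn
    (hinteg u).integrableOn] at h0
  have h1 := integral_comp_neg_Iic 0
    fun x : ℝ ↦ f ((-x : ℝ) : ℂ) * Complex.exp (Complex.I * (u * ((-x : ℝ) : ℂ)))
  simp only [neg_neg, neg_zero] at h1
  have h2 : ∀ x : ℝ, f ((-x : ℝ) : ℂ) * Complex.exp (Complex.I * (u * ((-x : ℝ) : ℂ)))
      = -(f x * Complex.exp (Complex.I * (((-u : ℝ) : ℂ) * x))) := by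
    intro x
    push_cast
    rw [hodd, neg_mul, mul_neg, neg_mul]
  rw [h1] at h0
  simp_rw [h2] at h0
  have hneg : IntegrableOn
      (fun x : ℝ ↦ -(f x * Complex.exp (Complex.I * (((-u : ℝ) : ℂ) * x)))) (Set.Ioi 0) :=
    (hinteg (-u)).neg.integrableOn
  rw [← integral_add hneg (hinteg u).integrableOn] at h0
  have h3 : ∀ x : ℝ, -(f x * Complex.exp (Complex.I * (((-u : ℝ) : ℂ) * x)))
      + f x * Complex.exp (Complex.I * (u * x))
      = (2 * Complex.I) * (f x * (Real.sin (u * x) : ℂ)) := by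
    intro x
    push_cast
    rw [Complex.sin]
    have e1 : Complex.I * (-(u : ℂ) * x) = -(u * x) * Complex.I := by ring
    have e2 : Complex.I * ((u : ℂ) * x) = u * x * Complex.I := by ring
    rw [e1, e2]
    linear_combination (f x * (Complex.exp (-(u * x) * Complex.I)
      - Complex.exp (u * x * Complex.I))) * (-Complex.I_sq)
  simp_rw [h3] at h0
  rw [integral_const_mul] at h0
  simpa using h0

lemma integral_mul_besselJ_zero (hf : IsPaleyWiener L f) (hodd : ∀ z, f (-z) = -f z) {lam : ℝ}
    (hL : 0 ≤ L) (hlam : L < lam) :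
    ∫ x in Set.Ioi (0 : ℝ), f x * (besselJ 0 (lam * x) : ℂ) = 0 :=
  integral_mul_besselJ_zero_eq_zero hf.integrable.integrableOn (hL.trans_lt hlam) fun _ hu ↦
    hf.integral_Ioi_mul_sin_eq_zero hodd (hlam.trans_le hu)

lemma integrableOn_mul_besselJ (hf : IsPaleyWiener L f) {lam : ℝ} (hlam : 0 < lam) (n : ℕ) :
    IntegrableOn (fun x : ℝ ↦ f x * (besselJ n (lam * x) : ℂ)) (Set.Ioi 0) := by
  have hcJ : Continuous fun x : ℝ ↦ (besselJ n (lam * x) : ℂ) :=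
    Complex.continuous_ofReal.comp
      ((continuous_besselJ n).comp (continuous_const.mul continuous_id))
  obtain ⟨C, hC0, hC⟩ := exists_norm_besselJ_le n
  refine Integrable.mul_bdd (c := C) hf.integrable.integrableOn hcJ.aestronglyMeasurable ?_
  filter_upwards [ae_restrict_mem measurableSet_Ioi] with x hx
  rw [Complex.norm_real]
  exact hC _ (mul_nonneg hlam.le (le_of_lt hx))

lemma tendsto_mul_besselJ (hf : IsPaleyWiener L f) {lam : ℝ} (hlam : 0 < lam) (n : ℕ) :
    Filter.Tendsto (fun x : ℝ ↦ f x * (besselJ n (lam * x) : ℂ)) Filter.atTop (nhds 0) := by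
  obtain ⟨C, hC0, hC⟩ := exists_norm_besselJ_le n
  have h := hf.tendsto_ofReal_atTop.norm.mul_const C
  rw [norm_zero, zero_mul] at h
  refine squeeze_zero_norm' ?_ h
  filter_upwards [Filter.eventually_ge_atTop 0] with x hx
  rw [norm_mul, Complex.norm_real]
  exact mul_le_mul_of_nonneg_left (hC _ (mul_nonneg hlam.le hx)) (norm_nonneg _)

lemma hasDerivAt_mul_besselJ (hf : IsPaleyWiener L f) (lam : ℝ) {n : ℕ} {x D : ℝ}
    (hD : HasDerivAt (besselJ n) D (lam * x)) :
    HasDerivAt (fun x : ℝ ↦ f x * (besselJ n (lam * x) : ℂ))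
      (_root_.deriv f x * (besselJ n (lam * x) : ℂ) + f x * ((D * lam : ℝ) : ℂ)) x := by
  have h1 : HasDerivAt (fun x : ℝ ↦ f x) (_root_.deriv f x) x :=
    (hf.differentiable (x : ℂ)).hasDerivAt.comp_ofReal
  have h2 : HasDerivAt (fun x : ℝ ↦ besselJ n (lam * x)) (D * lam) x := by
    have h3 : HasDerivAt (fun x : ℝ ↦ lam * x) lam x := by
      simpa using (hasDerivAt_id x).const_mul lam
    exact hD.comp x h3
  exact h1.mul h2.ofReal_comp

lemma integral_mul_besselJ_one (hf : IsPaleyWiener L f) {lam : ℝ} (hL : 0 ≤ L) (hlam : 0 < lam) :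
    ∫ x in Set.Ioi (0 : ℝ), f x * (besselJ 1 (lam * x) : ℂ)
      = 1 / lam * (f 0 + ∫ x in Set.Ioi (0 : ℝ), _root_.deriv f x * (besselJ 0 (lam * x) : ℂ)) := by
  have hi0 := (hf.deriv hL).integrableOn_mul_besselJ hlam 0
  have hi1 := hf.integrableOn_mul_besselJ hlam 1
  have e : ∀ x : ℝ, _root_.deriv f x * (besselJ 0 (lam * x) : ℂ)
      + f x * ((-besselJ 1 (lam * x) * lam : ℝ) : ℂ)
      = _root_.deriv f x * (besselJ 0 (lam * x) : ℂ)
        - lam * (f x * (besselJ 1 (lam * x) : ℂ)) := by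
    intro x
    push_cast
    ring
  have h := integral_Ioi_of_hasDerivAt_of_tendsto' (a := 0)
    (fun x _ ↦ hf.hasDerivAt_mul_besselJ lam (hasDerivAt_besselJ_zero (lam * x)))
    (by
      simp_rw [e]
      exact hi0.sub (hi1.const_mul _))
    (hf.tendsto_mul_besselJ hlam 0)
  simp_rw [e] at h
  rw [integral_sub hi0 (hi1.const_mul _), integral_const_mul] at h
  simp only [Complex.ofReal_zero, mul_zero, besselJ_zero_zero, Complex.ofReal_one, mul_one] at h
  have hl : (lam : ℂ) ≠ 0 := by exact_mod_cast hlam.ne'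
  field_simp
  linear_combination -h

lemma integral_mul_besselJ_add_two (hf : IsPaleyWiener L f) {lam : ℝ} (hL : 0 ≤ L) (hlam : 0 < lam)
    (n : ℕ) :
    ∫ x in Set.Ioi (0 : ℝ), f x * (besselJ (n + 2) (lam * x) : ℂ)
      = (∫ x in Set.Ioi (0 : ℝ), f x * (besselJ n (lam * x) : ℂ))
        + 2 / lam * ∫ x in Set.Ioi (0 : ℝ),
          _root_.deriv f x * (besselJ (n + 1) (lam * x) : ℂ) := by
  have hi0 := (hf.deriv hL).integrableOn_mul_besselJ hlam (n + 1)
  have hi1 := hf.integrableOn_mul_besselJ hlam n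
  have hi2 := hf.integrableOn_mul_besselJ hlam (n + 2)
  have hi12 : IntegrableOn (fun x : ℝ ↦ (lam / 2 : ℂ) * (f x * (besselJ n (lam * x) : ℂ)
      - f x * (besselJ (n + 2) (lam * x) : ℂ))) (Set.Ioi 0) := (hi1.sub hi2).const_mul _
  have e : ∀ x : ℝ, _root_.deriv f x * (besselJ (n + 1) (lam * x) : ℂ)
      + f x * (((besselJ n (lam * x) - besselJ (n + 2) (lam * x)) / 2 * lam : ℝ) : ℂ)
      = _root_.deriv f x * (besselJ (n + 1) (lam * x) : ℂ)
        + lam / 2 * (f x * (besselJ n (lam * x) : ℂ) - f x * (besselJ (n + 2) (lam * x) : ℂ)) := by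
    intro x
    push_cast
    ring
  have h := integral_Ioi_of_hasDerivAt_of_tendsto' (a := 0)
    (fun x _ ↦ hf.hasDerivAt_mul_besselJ lam (hasDerivAt_besselJ_succ n (lam * x)))
    (by
      simp_rw [e]
      exact hi0.add hi12)
    (hf.tendsto_mul_besselJ hlam (n + 1))
  simp_rw [e] at h
  rw [integral_add hi0 hi12, integral_const_mul, integral_sub hi1 hi2] at h
  simp only [Complex.ofReal_zero, mul_zero, besselJ_succ_zero, sub_zero] at h
  have hl : (lam : ℂ) ≠ 0 := by exact_mod_cast hlam.ne'
  field_simp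
  linear_combination -2 * h

end IsPaleyWiener

lemma deriv_neg_of_parity {f : ℂ → ℂ} {s : ℂ} (hpar : ∀ z, f (-z) = s * f z)
    (z : ℂ) : deriv f (-z) = -s * deriv f z := by
  have h1 : deriv (fun z ↦ f (-z)) z = -deriv f (-z) := deriv_comp_neg f z
  have h2 : (fun z ↦ f (-z)) = fun z ↦ s * f z := funext hpar
  rw [h2, deriv_const_mul_field] at h1
  linear_combination h1

namespace IsPaleyWiener

variable {L : ℝ}

/-- Functions vanishing to order `k` at the origin, against `J_{k+1}`. -/
lemma integral_mul_besselJ_succ {lam : ℝ} (hL : 0 ≤ L) (hlam : L < lam) (k : ℕ) :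
    ∀ f : ℂ → ℂ, IsPaleyWiener L f → (∀ z, f (-z) = (-1) ^ k * f z) →
      (∀ j < k, iteratedDeriv j f 0 = 0) →
      ∫ x in Set.Ioi (0 : ℝ), f x * (besselJ (k + 1) (lam * x) : ℂ)
        = 1 / lam * (2 / lam) ^ k * iteratedDeriv k f 0 := by
  have hlam0 : 0 < lam := hL.trans_lt hlam
  induction k using Nat.strong_induction_on with
  | _ k ih =>
  intro f hf hpar hvan
  rcases k with _ | k
  · rw [hf.integral_mul_besselJ_one hL hlam0, (hf.deriv hL).integral_mul_besselJ_zero _ hL hlam]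
    · simp
    · intro z
      rw [deriv_neg_of_parity hpar]
      simp
  · have hpar' : ∀ z, _root_.deriv f (-z) = (-1) ^ k * _root_.deriv f z := by
      intro z
      rw [deriv_neg_of_parity hpar]
      ring
    rw [hf.integral_mul_besselJ_add_two hL hlam0 k,
      ih k (Nat.lt_succ_self k) (_root_.deriv f) (hf.deriv hL) hpar' fun j hj ↦ by
        rw [← iteratedDeriv_succ']
        exact hvan (j + 1) (by omega),
      ← iteratedDeriv_succ']
    have h0 : ∫ x in Set.Ioi (0 : ℝ), f x * (besselJ k (lam * x) : ℂ) = 0 := by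
      rcases k with _ | k
      · refine hf.integral_mul_besselJ_zero (fun z ↦ ?_) hL hlam
        rw [hpar]
        simp
      · rw [ih k (by omega) f hf (fun z ↦ by rw [hpar]; ring) fun j hj ↦ hvan j (by omega),
          hvan k (by omega), mul_zero]
    rw [h0]
    ring

/-- Functions vanishing to order `k` at the origin, against `J_{k+3}`. -/
lemma integral_mul_besselJ_add_three {lam : ℝ} (hL : 0 ≤ L) (hlam : L < lam) (k : ℕ) :
    ∀ f : ℂ → ℂ, IsPaleyWiener L f → (∀ z, f (-z) = (-1) ^ k * f z) →
      (∀ j < k, iteratedDeriv j f 0 = 0) →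
      ∫ x in Set.Ioi (0 : ℝ), f x * (besselJ (k + 3) (lam * x) : ℂ)
        = 1 / lam * (2 / lam) ^ k *
          ((2 / lam) ^ 2 * iteratedDeriv (k + 2) f 0 + (k + 1) * iteratedDeriv k f 0) := by
  have hlam0 : 0 < lam := hL.trans_lt hlam
  induction k with
  | zero =>
    intro f hf hpar hvan
    have hpar' : ∀ z, _root_.deriv f (-z) = (-1) ^ 1 * _root_.deriv f z := by
      intro z
      rw [deriv_neg_of_parity hpar]
      ring
    rw [hf.integral_mul_besselJ_add_two hL hlam0 1,
      integral_mul_besselJ_succ hL hlam 0 f hf hpar (by simp),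
      integral_mul_besselJ_succ hL hlam 1 (_root_.deriv f) (hf.deriv hL) hpar' ?_,
      ← iteratedDeriv_succ']
    · push_cast
      ring
    · intro j hj
      obtain rfl : j = 0 := by omega
      have := hpar' 0
      rw [neg_zero, pow_one, neg_one_mul, CharZero.eq_neg_self_iff] at this
      simpa using this
  | succ k ih =>
    intro f hf hpar hvan
    have hpar' : ∀ z, _root_.deriv f (-z) = (-1) ^ k * _root_.deriv f z := by
      intro z
      rw [deriv_neg_of_parity hpar]
      ring
    rw [hf.integral_mul_besselJ_add_two hL hlam0 (k + 2),
      integral_mul_besselJ_succ hL hlam (k + 1) f hf hpar hvan,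
      ih (_root_.deriv f) (hf.deriv hL) hpar' fun j hj ↦ by
        rw [← iteratedDeriv_succ']
        exact hvan (j + 1) (by omega),
      ← iteratedDeriv_succ', ← iteratedDeriv_succ']
    push_cast
    ring_nf

end IsPaleyWiener

/-! ### The entire function `1 / (Γ(α + w) Γ(α - w))` -/

/-- The entire even function `1 / (Γ(α + w) Γ(α - w))`. -/
noncomputable def invGammaPair (α : ℝ) (w : ℂ) : ℂ :=
  (Complex.Gamma (α + w) * Complex.Gamma (α - w))⁻¹

lemma Complex.norm_sin_le_exp_abs_im (z : ℂ) : ‖Complex.sin z‖ ≤ Real.exp |z.im| := by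
  have h1 : ‖Complex.exp (-z * Complex.I)‖ ≤ Real.exp |z.im| := by
    rw [Complex.norm_exp]
    exact Real.exp_le_exp.2 (by simpa using le_abs_self z.im)
  have h2 : ‖Complex.exp (z * Complex.I)‖ ≤ Real.exp |z.im| := by
    rw [Complex.norm_exp]
    exact Real.exp_le_exp.2 (by simpa using neg_le_abs z.im)
  rw [Complex.sin, norm_div, norm_mul, Complex.norm_I, mul_one, Complex.norm_ofNat]
  have := norm_sub_le (Complex.exp (-z * Complex.I)) (Complex.exp (z * Complex.I))
  linarith

lemma differentiable_invGammaPair (α : ℝ) : Differentiable ℂ (invGammaPair α) := by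
  unfold invGammaPair
  simp_rw [mul_inv]
  refine Differentiable.mul (Complex.differentiable_one_div_Gamma.comp ?_)
    (Complex.differentiable_one_div_Gamma.comp ?_) <;> fun_prop

lemma invGammaPair_neg (α : ℝ) (w : ℂ) : invGammaPair α (-w) = invGammaPair α w := by
  rw [invGammaPair, invGammaPair, sub_neg_eq_add, ← sub_eq_add_neg, mul_comm]

lemma invGammaPair_eq_mul_add_one (α : ℝ) (w : ℂ) :
    invGammaPair α w = ((α : ℂ) ^ 2 - w ^ 2) * invGammaPair (α + 1) w := by
  simp only [invGammaPair, mul_inv]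
  rw [Complex.one_div_Gamma_eq_self_mul_one_div_Gamma_add_one (α + w),
    Complex.one_div_Gamma_eq_self_mul_one_div_Gamma_add_one (α - w)]
  push_cast
  rw [show (α : ℂ) + w + 1 = α + 1 + w by ring, show (α : ℂ) - w + 1 = α + 1 - w by ring]
  ring

lemma invGammaPair_ofReal (α x : ℝ) :
    invGammaPair α x = ((Real.Gamma (α + x) * Real.Gamma (α - x))⁻¹ : ℝ) := by
  simp [invGammaPair, ← Complex.Gamma_ofReal]

lemma Complex.inv_Gamma_eq_sin_mul {s : ℂ} (hs : s.re < 1) :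
    (Complex.Gamma s)⁻¹ = Complex.sin (π * s) / π * Complex.Gamma (1 - s) := by
  have h : Complex.Gamma (1 - s) ≠ 0 := Complex.Gamma_ne_zero_of_re_pos (by simpa using hs)
  rw [← inv_div, ← Complex.Gamma_mul_Gamma_one_sub, mul_inv, inv_mul_cancel_right₀ h]

/-- A bound for the quotient `Γ(1 - α + w) / Γ(α + w)` bounds the entire function. -/
lemma norm_invGammaPair_le {α : ℝ} (hα1 : α < 1) {w : ℂ} (hw : 0 ≤ w.re) :
    ‖invGammaPair α w‖ ≤
      ‖Complex.Gamma (1 - α + w)‖ / ‖Complex.Gamma (α + w)‖ * Real.exp (π * |w.im|) := by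
  have hs : ((α : ℂ) - w).re < 1 := by
    simp only [Complex.sub_re, Complex.ofReal_re]
    linarith
  rw [invGammaPair, mul_inv, Complex.inv_Gamma_eq_sin_mul hs,
    show 1 - ((α : ℂ) - w) = 1 - α + w by ring, norm_mul, norm_mul, norm_div, norm_inv]
  have h1 := Complex.norm_sin_le_exp_abs_im (π * (α - w))
  have h2 : |((π : ℂ) * (α - w)).im| = π * |w.im| := by
    simp [abs_mul, abs_of_pos Real.pi_pos]
  rw [h2] at h1
  have h3 : ‖Complex.sin (π * (α - w))‖ / ‖(π : ℂ)‖ ≤ Real.exp (π * |w.im|) := by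
    rw [Complex.norm_real, Real.norm_of_nonneg Real.pi_pos.le]
    refine (div_le_self (norm_nonneg _) ?_).trans h1
    linarith [Real.pi_gt_three]
  calc ‖Complex.Gamma (α + w)‖⁻¹ * (‖Complex.sin (π * (α - w))‖ / ‖(π : ℂ)‖
        * ‖Complex.Gamma (1 - α + w)‖)
      ≤ ‖Complex.Gamma (α + w)‖⁻¹ * (Real.exp (π * |w.im|) * ‖Complex.Gamma (1 - α + w)‖) := by
        gcongr
    _ = _ := by ring

lemma Complex.norm_betaIntegral_le {u v : ℂ} {a : ℝ} (ha : 0 < a) (hu : a ≤ u.re)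
    (hv : 0 < v.re) :
    ‖Complex.betaIntegral u v‖ ≤
      ∫ x in (0 : ℝ)..1, ‖(x : ℂ) ^ ((a : ℂ) - 1) * (1 - (x : ℂ)) ^ (v - 1)‖ := by
  refine intervalIntegral.norm_integral_le_of_norm_le zero_le_one ?_
    (Complex.betaIntegral_convergent (u := a) (by simpa using ha) hv).norm
  refine Filter.Eventually.of_forall fun x hx ↦ ?_
  rw [norm_mul, norm_mul, Complex.norm_cpow_eq_rpow_re_of_pos hx.1,
    Complex.norm_cpow_eq_rpow_re_of_pos hx.1]
  refine mul_le_mul_of_nonneg_right ?_ (norm_nonneg _)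
  refine Real.rpow_le_rpow_of_exponent_ge hx.1 hx.2 ?_
  simpa using hu

lemma exists_norm_Gamma_div_le {α : ℝ} (hα : 0 < α) (hα1 : α < 1) :
    ∃ C : ℝ, 0 ≤ C ∧ ∀ w : ℂ, 0 ≤ w.re →
      ‖Complex.Gamma (1 - α + w)‖ / ‖Complex.Gamma (α + w)‖ ≤ C * (1 + ‖w‖) := by
  have h2 : 0 < ((2 * α : ℝ) : ℂ).re := by
    rw [Complex.ofReal_re]
    positivity
  have hG : 0 < ‖Complex.Gamma ((2 * α : ℝ) : ℂ)‖ :=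
    norm_pos_iff.2 (Complex.Gamma_ne_zero_of_re_pos h2)
  set K := ∫ x in (0 : ℝ)..1,
    ‖(x : ℂ) ^ (((1 - α : ℝ) : ℂ) - 1) * (1 - (x : ℂ)) ^ (((2 * α : ℝ) : ℂ) - 1)‖ with hK
  have hK0 : 0 ≤ K := intervalIntegral.integral_nonneg zero_le_one fun _ _ ↦ norm_nonneg _
  refine ⟨K / ‖Complex.Gamma ((2 * α : ℝ) : ℂ)‖, by positivity, fun w hw ↦ ?_⟩
  have hre : 1 - α ≤ (1 - (α : ℂ) + w).re := by
    simp only [Complex.add_re, Complex.sub_re, Complex.one_re, Complex.ofReal_re]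
    linarith
  have hre' : 0 < ((α : ℂ) + w).re := by
    simp only [Complex.add_re, Complex.ofReal_re]
    linarith
  have hne : (α : ℂ) + w ≠ 0 := fun h ↦ by simp [h] at hre'
  have hB := Complex.Gamma_mul_Gamma_eq_betaIntegral
    (lt_of_lt_of_le (sub_pos.2 hα1) hre) h2
  rw [show 1 - (α : ℂ) + w + ((2 * α : ℝ) : ℂ) = α + w + 1 by push_cast; ring,
    Complex.Gamma_add_one _ hne] at hB
  have hB' := congrArg norm hB
  rw [norm_mul, norm_mul, norm_mul] at hB'
  have hb := Complex.norm_betaIntegral_le (sub_pos.2 hα1) hre h2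
  have hn : ‖(α : ℂ) + w‖ ≤ 1 + ‖w‖ := by
    refine (norm_add_le _ _).trans ?_
    rw [Complex.norm_real, Real.norm_of_nonneg hα.le]
    linarith
  have hGa : 0 < ‖Complex.Gamma (α + w)‖ :=
    norm_pos_iff.2 (Complex.Gamma_ne_zero_of_re_pos hre')
  rw [div_le_iff₀ hGa, ← mul_le_mul_iff_left₀ hG, hB']
  calc ‖(α : ℂ) + w‖ * ‖Complex.Gamma (α + w)‖
        * ‖Complex.betaIntegral (1 - α + w) ((2 * α : ℝ) : ℂ)‖
      ≤ (1 + ‖w‖) * ‖Complex.Gamma (α + w)‖ * K := by gcongr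
    _ = _ := by field_simp

lemma Real.Gamma_add_le_rpow_mul {y s : ℝ} (hy : 0 < y) (hs : 0 ≤ s) (hs1 : s ≤ 1) :
    Real.Gamma (y + s) ≤ y ^ s * Real.Gamma y := by
  rcases hs.eq_or_lt with rfl | hs
  · simp
  rcases hs1.eq_or_lt with rfl | hs1
  · rw [Real.Gamma_add_one hy.ne', Real.rpow_one]
  have h := Real.Gamma_mul_add_mul_le_rpow_Gamma_mul_rpow_Gamma hy (add_pos hy one_pos)
    (sub_pos.2 hs1) hs (by ring)
  have hG := Real.Gamma_pos_of_pos hy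
  rw [Real.Gamma_add_one hy.ne', Real.mul_rpow hy.le hG.le,
    show (1 - s) * y + s * (y + 1) = y + s by ring] at h
  refine h.trans_eq ?_
  rw [mul_left_comm, ← Real.rpow_add hG]
  simp

lemma exists_Gamma_div_le {α : ℝ} (hα : 0 < α) (hα1 : α < 1) :
    ∃ C : ℝ, 0 ≤ C ∧ ∀ x : ℝ, 0 ≤ x →
      Real.Gamma (1 - α + x) / Real.Gamma (α + x) ≤ C * (1 + x) ^ (1 - 2 * α) := by
  rcases le_total α (1 / 2) with h | h
  · refine ⟨1, zero_le_one, fun x hx ↦ ?_⟩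
    have hG : 0 < Real.Gamma (α + x) := Real.Gamma_pos_of_pos (by positivity)
    have h1 := Real.Gamma_add_le_rpow_mul (y := α + x) (s := 1 - 2 * α) (by positivity)
      (by linarith) (by linarith)
    rw [show α + x + (1 - 2 * α) = 1 - α + x by ring] at h1
    rw [div_le_iff₀ hG, one_mul]
    refine h1.trans (mul_le_mul_of_nonneg_right ?_ hG.le)
    exact Real.rpow_le_rpow (by positivity) (by linarith) (by linarith)
  · refine ⟨(1 - α)⁻¹, inv_nonneg.2 (by linarith), fun x hx ↦ ?_⟩
    have hG : 0 < Real.Gamma (α + x) := Real.Gamma_pos_of_pos (by positivity)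
    have hy : 0 < 1 - α + x := by linarith
    have h1 := Real.Gamma_add_le_rpow_mul (y := α + x) (s := 2 - 2 * α) (by positivity)
      (by linarith) (by linarith)
    rw [show α + x + (2 - 2 * α) = 1 - α + x + 1 by ring, Real.Gamma_add_one hy.ne'] at h1
    have h2 : (α + x) ^ (2 - 2 * α) ≤ (1 + x) ^ (2 - 2 * α) :=
      Real.rpow_le_rpow (by positivity) (by linarith) (by linarith)
    have h3 : (1 + x) ^ (2 - 2 * α) = (1 + x) ^ (1 - 2 * α) * (1 + x) := by
      rw [show 2 - 2 * α = 1 - 2 * α + 1 by ring, Real.rpow_add_one (by positivity)]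
    have h4 : (1 - α) * (1 + x) ≤ 1 - α + x := by nlinarith
    have hp : 0 < (1 + x) ^ (1 - 2 * α) := by positivity
    have hα' : 0 < 1 - α := by linarith
    have hG' : 0 < Real.Gamma (1 - α + x) := Real.Gamma_pos_of_pos hy
    have h5 : (1 - α) * (1 + x) * Real.Gamma (1 - α + x)
        ≤ (1 + x) ^ (1 - 2 * α) * (1 + x) * Real.Gamma (α + x) :=
      (mul_le_mul_of_nonneg_right h4 hG'.le).trans
        (h1.trans (mul_le_mul_of_nonneg_right (h3 ▸ h2) hG.le))
    rw [div_le_iff₀ hG, inv_mul_eq_div, div_mul_eq_mul_div, le_div_iff₀ hα']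
    have hx1 : 0 < 1 + x := by positivity
    nlinarith

/-- `f` is bounded on `S` by a multiple of `(1 + ‖w‖) ^ e * exp (L |Im w|)`. -/
def HasGrowthOn (S : Set ℂ) (e L : ℝ) (f : ℂ → ℂ) : Prop :=
  ∃ C : ℝ, 0 ≤ C ∧ ∀ w ∈ S, ‖f w‖ ≤ C * ((1 + ‖w‖) ^ e * Real.exp (L * |w.im|))

lemma HasGrowthOn.mono {S : Set ℂ} {e e' L : ℝ} {f : ℂ → ℂ} (h : HasGrowthOn S e L f)
    (he : e ≤ e') : HasGrowthOn S e' L f := by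
  obtain ⟨C, hC, h⟩ := h
  refine ⟨C, hC, fun w hw ↦ (h w hw).trans ?_⟩
  have : (1 + ‖w‖) ^ e ≤ (1 + ‖w‖) ^ e' :=
    Real.rpow_le_rpow_of_exponent_le (by linarith [norm_nonneg w]) he
  gcongr

lemma HasGrowthOn.mul {S : Set ℂ} {e e' L L' : ℝ} {f g : ℂ → ℂ} (hf : HasGrowthOn S e L f)
    (hg : HasGrowthOn S e' L' g) : HasGrowthOn S (e + e') (L + L') fun z ↦ f z * g z := by
  obtain ⟨C, hC, hf⟩ := hf
  obtain ⟨D, hD, hg⟩ := hg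
  refine ⟨C * D, by positivity, fun w hw ↦ ?_⟩
  rw [norm_mul, Real.rpow_add (by positivity), add_mul, Real.exp_add]
  refine (mul_le_mul (hf w hw) (hg w hw) (norm_nonneg _) (by positivity)).trans_eq ?_
  ring

lemma HasGrowthOn.prod {ι : Type*} (s : Finset ι) {S : Set ℂ} {e L : ι → ℝ} {f : ι → ℂ → ℂ}
    (hf : ∀ i ∈ s, HasGrowthOn S (e i) (L i) (f i)) :
    HasGrowthOn S (∑ i ∈ s, e i) (∑ i ∈ s, L i) fun z ↦ ∏ i ∈ s, f i z := by
  classical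
  induction s using Finset.induction_on with
  | empty => exact ⟨1, zero_le_one, by simp⟩
  | insert i s hi ih =>
    simp_rw [Finset.prod_insert hi, Finset.sum_insert hi]
    exact (hf i (Finset.mem_insert_self i s)).mul
      (ih fun j hj ↦ hf j (Finset.mem_insert_of_mem hj))

lemma HasGrowthOn.pow {S : Set ℂ} {e L : ℝ} {f : ℂ → ℂ} (hf : HasGrowthOn S e L f) (n : ℕ) :
    HasGrowthOn S (n * e) (n * L) fun z ↦ f z ^ n := by
  simpa using HasGrowthOn.prod (Finset.range n) (fun _ _ ↦ hf)

lemma hasGrowthOn_id (S : Set ℂ) : HasGrowthOn S 1 0 fun z ↦ z :=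
  ⟨1, zero_le_one, fun w _ ↦ by simp⟩

lemma exists_one_add_mul_rpow_le {b : ℝ} (hb : 0 < b) (e : ℝ) :
    ∃ C : ℝ, 0 ≤ C ∧ ∀ x : ℝ, 0 ≤ x → (1 + b * x) ^ e ≤ C * (1 + x) ^ e := by
  rcases le_total 0 e with he | he
  · refine ⟨(1 + b) ^ e, by positivity, fun x hx ↦ ?_⟩
    rw [← Real.mul_rpow (by positivity) (by positivity)]
    exact Real.rpow_le_rpow (by positivity) (by nlinarith) he
  · have hm : 0 < min 1 b := lt_min one_pos hb
    refine ⟨min 1 b ^ e, by positivity, fun x hx ↦ ?_⟩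
    rw [← Real.mul_rpow hm.le (by positivity)]
    refine Real.rpow_le_rpow_of_nonpos (by positivity) ?_ he
    nlinarith [min_le_left 1 b, mul_le_mul_of_nonneg_right (min_le_right 1 b) hx]

lemma HasGrowthOn.comp_mul {S : Set ℂ} {e L : ℝ} {f : ℂ → ℂ} (hf : HasGrowthOn S e L f)
    {b : ℝ} (hb : 0 < b) (hS : ∀ z ∈ S, (b : ℂ) * z ∈ S) :
    HasGrowthOn S e (L * b) fun z ↦ f (b * z) := by
  obtain ⟨C, hC, hf⟩ := hf
  obtain ⟨D, hD, h⟩ := exists_one_add_mul_rpow_le hb e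
  refine ⟨C * D, by positivity, fun w hw ↦ (hf _ (hS w hw)).trans ?_⟩
  rw [norm_mul, Complex.norm_real, Real.norm_of_nonneg hb.le, Complex.im_ofReal_mul, abs_mul,
    abs_of_pos hb, ← mul_assoc L, mul_assoc C D, ← mul_assoc D]
  exact mul_le_mul_of_nonneg_left
    (mul_le_mul_of_nonneg_right (h _ (norm_nonneg w)) (Real.exp_nonneg _)) hC

lemma HasGrowthOn.invGammaPair_add_one {S : Set ℂ} {e α : ℝ} (hα : 0 ≤ α)
    (h : HasGrowthOn S e π (invGammaPair α)) : HasGrowthOn S (e - 2) π (invGammaPair (α + 1)) := by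
  obtain ⟨C, hC, h⟩ := h
  obtain ⟨K, hK⟩ := (isCompact_closedBall (0 : ℂ) (α + 1)).exists_bound_of_continuousOn
    (f := fun w : ℂ ↦ ‖invGammaPair (α + 1) w‖ * (1 + ‖w‖) ^ (2 - e))
    (((differentiable_invGammaPair _).continuous.norm.mul
      ((continuous_const.add continuous_norm).rpow_const fun w ↦
        Or.inl (add_pos_of_pos_of_nonneg one_pos (norm_nonneg w)).ne')).continuousOn)
  have hK0 : 0 ≤ K := (norm_nonneg _).trans (hK 0 (by simpa using by positivity))
  refine ⟨K + 4 * (α + 1) * C, by positivity, fun w hw ↦ ?_⟩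
  have hw0 : 0 < 1 + ‖w‖ := by positivity
  have hE : 1 ≤ Real.exp (π * |w.im|) := Real.one_le_exp (by positivity)
  rw [add_mul]
  rcases le_total ‖w‖ (α + 1) with hle | hle
  · have h1 := hK w (by simpa using hle)
    rw [Real.norm_of_nonneg (by positivity)] at h1
    refine le_add_of_le_of_nonneg ?_ (by positivity)
    have h2 : ‖invGammaPair (α + 1) w‖ ≤ K * (1 + ‖w‖) ^ (e - 2) := by
      rw [show e - 2 = -(2 - e) by ring, Real.rpow_neg hw0.le, ← div_eq_mul_inv,
        le_div_iff₀ (by positivity)]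
      exact h1
    refine h2.trans (mul_le_mul_of_nonneg_left ?_ hK0)
    exact le_mul_of_one_le_right (by positivity) hE
  · refine le_add_of_nonneg_of_le (by positivity) ?_
    have h1 := h w hw
    rw [invGammaPair_eq_mul_add_one, norm_mul] at h1
    have h2 : ‖w‖ ^ 2 - α ^ 2 ≤ ‖(α : ℂ) ^ 2 - w ^ 2‖ := by
      have := norm_sub_norm_le (w ^ 2) ((α : ℂ) ^ 2)
      rw [norm_sub_rev, norm_pow, norm_pow, Complex.norm_real, Real.norm_of_nonneg hα] at this
      exact this
    have h3 : (1 + ‖w‖) ^ 2 ≤ 4 * (α + 1) * (‖w‖ ^ 2 - α ^ 2) := by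
      have a1 : ‖w‖ ≤ (α + 1) * (‖w‖ - α) := by nlinarith
      have a2 : ‖w‖ * ‖w‖ ≤ (α + 1) * (‖w‖ - α) * (‖w‖ + α) :=
        mul_le_mul a1 (by linarith) (norm_nonneg w) (by nlinarith)
      nlinarith
    rw [Real.rpow_sub hw0, Real.rpow_two]
    have h4 : (1 + ‖w‖) ^ 2 * ‖invGammaPair (α + 1) w‖
        ≤ 4 * (α + 1) * (C * ((1 + ‖w‖) ^ e * Real.exp (π * |w.im|))) :=
      calc (1 + ‖w‖) ^ 2 * ‖invGammaPair (α + 1) w‖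
          ≤ 4 * (α + 1) * ‖(α : ℂ) ^ 2 - w ^ 2‖ * ‖invGammaPair (α + 1) w‖ := by
            refine mul_le_mul_of_nonneg_right (h3.trans ?_) (norm_nonneg _)
            gcongr
        _ = 4 * (α + 1) * (‖(α : ℂ) ^ 2 - w ^ 2‖ * ‖invGammaPair (α + 1) w‖) := by ring
        _ ≤ _ := by gcongr
    rw [← mul_le_mul_iff_right₀ (pow_pos hw0 2)]
    refine h4.trans_eq ?_
    field_simp

lemma HasGrowthOn.invGammaPair_add_nat {S : Set ℂ} {e α : ℝ} (hα : 0 ≤ α)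
    (h : HasGrowthOn S e π (invGammaPair α)) (n : ℕ) :
    HasGrowthOn S (e - 2 * n) π (invGammaPair (α + n)) := by
  induction n with
  | zero => simpa using h
  | succ n ih =>
    have := ih.invGammaPair_add_one (by positivity)
    convert this using 1
    · push_cast
      ring
    · push_cast
      rw [add_assoc]

lemma hasGrowthOn_invGammaPair_zero (S : Set ℂ) : HasGrowthOn S 1 π (invGammaPair 0) := by
  suffices h : HasGrowthOn Set.univ 1 π (invGammaPair 0) from
    let ⟨C, hC, h⟩ := h
    ⟨C, hC, fun w _ ↦ h w trivial⟩
  refine ⟨1, zero_le_one, fun w _ ↦ ?_⟩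
  wlog hw : 0 ≤ w.re generalizing w
  · have := this (-w) (Set.mem_univ _) (by simp only [Complex.neg_re]; linarith)
    simpa [invGammaPair_neg] using this
  have h := norm_invGammaPair_le (α := 0) one_pos hw
  have h1 : ‖Complex.Gamma (1 - (0 : ℝ) + w)‖ / ‖Complex.Gamma ((0 : ℝ) + w)‖ ≤ 1 + ‖w‖ := by
    rcases eq_or_ne w 0 with rfl | hw0
    · simp
    · rw [Complex.ofReal_zero, sub_zero, zero_add, add_comm, Complex.Gamma_add_one _ hw0, norm_mul]
      exact (div_le_of_le_mul₀ (norm_nonneg _) (norm_nonneg _) le_rfl).trans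
        (le_add_of_nonneg_left zero_le_one)
  rw [one_mul, Real.rpow_one]
  exact h.trans (mul_le_mul_of_nonneg_right h1 (Real.exp_nonneg _))

lemma hasGrowthOn_univ_invGammaPair {α : ℝ} (hα : 0 ≤ α) :
    HasGrowthOn Set.univ 1 π (invGammaPair α) := by
  have base : HasGrowthOn Set.univ 1 π (invGammaPair (Int.fract α)) := by
    rcases (Int.fract_nonneg α).eq_or_lt with h0 | h0
    · rw [← h0]
      exact hasGrowthOn_invGammaPair_zero _
    obtain ⟨C, hC, h⟩ := exists_norm_Gamma_div_le h0 (Int.fract_lt_one α)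
    refine ⟨C, hC, fun w _ ↦ ?_⟩
    wlog hw : 0 ≤ w.re generalizing w
    · have := this (-w) (Set.mem_univ _) (by simp only [Complex.neg_re]; linarith)
      simpa [invGammaPair_neg] using this
    rw [Real.rpow_one, ← mul_assoc]
    exact (norm_invGammaPair_le (Int.fract_lt_one α) hw).trans
      (mul_le_mul_of_nonneg_right (h w hw) (Real.exp_nonneg _))
  have := base.invGammaPair_add_nat (Int.fract_nonneg α) ⌊α⌋₊
  rw [natCast_floor_eq_intCast_floor hα, Int.fract_add_floor] at this
  exact this.mono (by simpa using Int.floor_nonneg.2 hα)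

lemma hasGrowthOn_real_invGammaPair {α : ℝ} (hα : 0 ≤ α) :
    HasGrowthOn (Set.range ((↑) : ℝ → ℂ)) (1 - 2 * α) π (invGammaPair α) := by
  have base : HasGrowthOn (Set.range ((↑) : ℝ → ℂ)) (1 - 2 * Int.fract α) π
      (invGammaPair (Int.fract α)) := by
    rcases (Int.fract_nonneg α).eq_or_lt with h0 | h0
    · rw [← h0]
      simpa using hasGrowthOn_invGammaPair_zero _
    obtain ⟨C, hC, h⟩ := exists_Gamma_div_le h0 (Int.fract_lt_one α)
    refine ⟨C, hC, ?_⟩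
    rintro _ ⟨x, rfl⟩
    wlog hx : 0 ≤ x generalizing x
    · have := this (-x) (by linarith)
      simpa [invGammaPair_neg] using this
    have h1 := norm_invGammaPair_le (w := x) (Int.fract_lt_one α) (by simpa using hx)
    rw [Complex.norm_real, Real.norm_of_nonneg hx, ← mul_assoc]
    refine h1.trans (mul_le_mul_of_nonneg_right ((le_of_eq ?_).trans (h x hx)) (Real.exp_nonneg _))
    have p1 : 0 < 1 - Int.fract α + x := by linarith [Int.fract_lt_one α]
    have p2 : 0 < Int.fract α + x := by positivity
    rw [show (1 : ℂ) - (Int.fract α : ℝ) + x = ((1 - Int.fract α + x : ℝ) : ℂ) by push_cast; ring,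
      show ((Int.fract α : ℝ) : ℂ) + x = ((Int.fract α + x : ℝ) : ℂ) by push_cast; ring,
      Complex.Gamma_ofReal, Complex.Gamma_ofReal, Complex.norm_real, Complex.norm_real,
      Real.norm_of_nonneg (Real.Gamma_pos_of_pos p1).le,
      Real.norm_of_nonneg (Real.Gamma_pos_of_pos p2).le]
  have := base.invGammaPair_add_nat (Int.fract_nonneg α) ⌊α⌋₊
  rw [natCast_floor_eq_intCast_floor hα, Int.fract_add_floor] at this
  convert this using 1
  linarith [Int.fract_add_floor α]

/-! ### Taylor coefficients at the origin -/

/-- `g` is entire and even, and `g z = a (1 + c z ^ 2 / 2 + O(z ^ 4))` at the origin. -/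
structure IsEvenEntire (g : ℂ → ℂ) (a c : ℂ) : Prop where
  differentiable : Differentiable ℂ g
  neg : ∀ z, g (-z) = g z
  map_zero : g 0 = a
  deriv_deriv : deriv (deriv g) 0 = a * c

namespace IsEvenEntire

variable {g h : ℂ → ℂ} {a b c d : ℂ}

lemma deriv_zero (hg : IsEvenEntire g a c) : deriv g 0 = 0 := by
  have h1 := deriv_neg_of_parity (f := g) (s := 1) (fun z ↦ by rw [hg.neg, one_mul]) (0 : ℂ)
  rw [neg_zero, neg_one_mul, CharZero.eq_neg_self_iff] at h1
  exact h1

lemma mul (hg : IsEvenEntire g a c) (hh : IsEvenEntire h b d) :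
    IsEvenEntire (fun z ↦ g z * h z) (a * b) (c + d) where
  differentiable := hg.differentiable.mul hh.differentiable
  neg z := by rw [hg.neg, hh.neg]
  map_zero := by rw [hg.map_zero, hh.map_zero]
  deriv_deriv := by
    have h1 : deriv (fun z ↦ g z * h z) = fun z ↦ deriv g z * h z + g z * deriv h z :=
      funext fun z ↦ deriv_fun_mul hg.differentiable.differentiableAt
        hh.differentiable.differentiableAt
    have h2 := ((hg.differentiable.deriv 0).hasDerivAt.mul (hh.differentiable 0).hasDerivAt).add
      ((hg.differentiable 0).hasDerivAt.mul (hh.differentiable.deriv 0).hasDerivAt)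
    rw [h1]
    refine h2.deriv.trans ?_
    rw [hg.deriv_deriv, hh.deriv_deriv, hg.deriv_zero, hh.deriv_zero, hg.map_zero, hh.map_zero]
    ring

protected lemma one : IsEvenEntire (fun _ ↦ 1) 1 0 where
  differentiable := differentiable_const _
  neg _ := rfl
  map_zero := rfl
  deriv_deriv := by simp

lemma prod {ι : Type*} (s : Finset ι) {g : ι → ℂ → ℂ} {a c : ι → ℂ}
    (hg : ∀ i ∈ s, IsEvenEntire (g i) (a i) (c i)) :
    IsEvenEntire (fun z ↦ ∏ i ∈ s, g i z) (∏ i ∈ s, a i) (∑ i ∈ s, c i) := by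
  classical
  induction s using Finset.induction_on with
  | empty => simpa using IsEvenEntire.one
  | insert i s hi ih =>
    simp_rw [Finset.prod_insert hi, Finset.sum_insert hi]
    exact (hg i (Finset.mem_insert_self i s)).mul
      (ih fun j hj ↦ hg j (Finset.mem_insert_of_mem hj))

lemma pow (hg : IsEvenEntire g a c) (n : ℕ) :
    IsEvenEntire (fun z ↦ g z ^ n) (a ^ n) (n * c) := by
  simpa using IsEvenEntire.prod (Finset.range n) (fun _ _ ↦ hg)

lemma comp_mul (hg : IsEvenEntire g a c) (b : ℂ) :
    IsEvenEntire (fun z ↦ g (b * z)) a (b ^ 2 * c) where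
  differentiable := hg.differentiable.comp (differentiable_id.const_mul b)
  neg z := by rw [mul_neg, hg.neg]
  map_zero := by rw [mul_zero, hg.map_zero]
  deriv_deriv := by
    have h1 : deriv (fun z ↦ g (b * z)) = fun z ↦ b * deriv g (b * z) :=
      funext fun z ↦ deriv_comp_mul_left b g z
    rw [h1, deriv_const_mul_field, deriv_comp_mul_left, mul_zero, hg.deriv_deriv, smul_eq_mul]
    ring

lemma iteratedDeriv_pow_mul (hg : IsEvenEntire g a c) (n k : ℕ) :
    iteratedDeriv k (fun z ↦ z ^ n * g z) 0
      = if n ≤ k then k.choose n * n.factorial * iteratedDeriv (k - n) g 0 else 0 := by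
  have hgc : ContDiffAt ℂ k g 0 := hg.differentiable.contDiff.contDiffAt
  rw [iteratedDeriv_fun_mul (by fun_prop) hgc]
  simp_rw [iteratedDeriv_fun_pow_zero]
  simp only [Nat.cast_ite, Nat.cast_zero, mul_ite, mul_zero, ite_mul, zero_mul,
    Finset.sum_ite_eq', Finset.mem_range, Nat.lt_succ_iff]

end IsEvenEntire

lemma differentiableAt_and_deriv_eq_ofReal_deriv {F : ℂ → ℂ} {q : ℝ → ℝ} (hF : Differentiable ℂ F)
    (hq : ∀ x : ℝ, F x = q x) (x : ℝ) :
    DifferentiableAt ℝ q x ∧ deriv F x = ((deriv q x : ℝ) : ℂ) := by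
  have h1 := (hF x).hasDerivAt.real_of_complex
  simp only [hq, Complex.ofReal_re] at h1
  refine ⟨h1.differentiableAt, ?_⟩
  have h2 := (hF x).hasDerivAt.comp_ofReal
  simp only [hq] at h2
  exact h2.unique h1.differentiableAt.hasDerivAt.ofReal_comp

lemma inv_Gamma_ofReal (x : ℝ) : (Complex.Gamma x)⁻¹ = ((Real.Gamma x)⁻¹ : ℝ) := by
  rw [Complex.Gamma_ofReal, Complex.ofReal_inv]

lemma deriv_inv_Gamma_ofReal (x : ℝ) :
    DifferentiableAt ℝ (fun x ↦ (Real.Gamma x)⁻¹) x ∧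
      deriv (fun s ↦ (Complex.Gamma s)⁻¹) x = ((deriv (fun x ↦ (Real.Gamma x)⁻¹) x : ℝ) : ℂ) :=
  differentiableAt_and_deriv_eq_ofReal_deriv Complex.differentiable_one_div_Gamma
    inv_Gamma_ofReal x

lemma deriv_deriv_inv_Gamma_ofReal (x : ℝ) :
    DifferentiableAt ℝ (deriv fun x ↦ (Real.Gamma x)⁻¹) x ∧
      deriv (deriv fun s ↦ (Complex.Gamma s)⁻¹) x
        = ((deriv (deriv fun x ↦ (Real.Gamma x)⁻¹) x : ℝ) : ℂ) :=
  differentiableAt_and_deriv_eq_ofReal_deriv Complex.differentiable_one_div_Gamma.deriv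
    (fun x ↦ (deriv_inv_Gamma_ofReal x).2) x

lemma polygamma_one_eq {a : ℝ} (ha : 0 < a) :
    polygamma 1 a = -((deriv (deriv fun x ↦ (Real.Gamma x)⁻¹) a * (Real.Gamma a)⁻¹
      - deriv (fun x ↦ (Real.Gamma x)⁻¹) a ^ 2) / (Real.Gamma a)⁻¹ ^ 2) := by
  have hev : digamma =ᶠ[nhds a] fun x ↦
      -(deriv (fun x ↦ (Real.Gamma x)⁻¹) x / (Real.Gamma x)⁻¹) := by
    filter_upwards [lt_mem_nhds ha] with x hx
    have hG := (Real.Gamma_pos_of_pos hx).ne'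
    have hd : DifferentiableAt ℝ Real.Gamma x := Real.differentiableAt_Gamma fun n ↦ by
      have : (0 : ℝ) ≤ n := n.cast_nonneg
      linarith
    rw [digamma, deriv_fun_inv'' hd hG]
    field_simp
  have hG : (Real.Gamma a)⁻¹ ≠ 0 := inv_ne_zero (Real.Gamma_pos_of_pos ha).ne'
  rw [polygamma, iteratedDeriv_one, hev.deriv_eq]
  have h := ((deriv_deriv_inv_Gamma_ofReal a).1.hasDerivAt.div
    (deriv_inv_Gamma_ofReal a).1.hasDerivAt hG).neg
  refine h.deriv.trans ?_
  rw [sq (deriv _ a)]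

lemma isEvenEntire_invGammaPair {α : ℝ} (hα : 0 < α) :
    IsEvenEntire (invGammaPair α) (((Real.Gamma α ^ 2)⁻¹ : ℝ) : ℂ)
      ((-2 * polygamma 1 α : ℝ) : ℂ) where
  differentiable := differentiable_invGammaPair α
  neg := invGammaPair_neg α
  map_zero := by
    have := invGammaPair_ofReal α 0
    rw [add_zero, sub_zero, Complex.ofReal_zero] at this
    rw [this, sq]
  deriv_deriv := by
    have hG := (Real.Gamma_pos_of_pos hα).ne'
    have hd := Complex.differentiable_one_div_Gamma
    set p : ℂ → ℂ := fun s ↦ (Complex.Gamma s)⁻¹ with hp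
    have hplus : ∀ w : ℂ, HasDerivAt (fun w : ℂ ↦ (α : ℂ) + w) 1 w := fun w ↦
      (hasDerivAt_id w).const_add _
    have hminus : ∀ w : ℂ, HasDerivAt (fun w : ℂ ↦ (α : ℂ) - w) (-1) w := fun w ↦
      (hasDerivAt_id w).const_sub _
    have e0 : invGammaPair α = fun w ↦ p (α + w) * p (α - w) :=
      funext fun w ↦ by rw [invGammaPair, mul_inv]
    have e1 : deriv (invGammaPair α)
        = fun w ↦ deriv p (α + w) * p (α - w) - p (α + w) * deriv p (α - w) := by
      funext w
      rw [e0]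
      refine (((hd _).hasDerivAt.comp w (hplus w)).mul
        ((hd _).hasDerivAt.comp w (hminus w))).deriv.trans ?_
      simp only [Function.comp_apply]
      ring
    rw [e1]
    refine ((((hd.deriv _).hasDerivAt.comp 0 (hplus 0)).mul
      ((hd _).hasDerivAt.comp 0 (hminus 0))).sub (((hd _).hasDerivAt.comp 0 (hplus 0)).mul
      ((hd.deriv _).hasDerivAt.comp 0 (hminus 0)))).deriv.trans ?_
    simp only [Function.comp_apply, add_zero, sub_zero, mul_one]
    rw [(deriv_inv_Gamma_ofReal α).2, (deriv_deriv_inv_Gamma_ofReal α).2, hp]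
    simp only [inv_Gamma_ofReal]
    rw [polygamma_one_eq hα]
    have hG' : (Real.Gamma α : ℂ) ≠ 0 := Complex.ofReal_ne_zero.2 hG
    push_cast
    field_simp
    ring

/-! ### Removing the regularizing factor -/

lemma HasGrowthOn.isPaleyWiener {L : ℝ} {f : ℂ → ℂ} (hf : HasGrowthOn Set.univ (-2) L f)
    (hd : Differentiable ℂ f) : IsPaleyWiener L f := by
  obtain ⟨C, -, h⟩ := hf
  refine ⟨hd, C, fun z ↦ (h z trivial).trans_eq ?_⟩
  rw [Real.rpow_neg (by positivity), Real.rpow_two]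
  ring

lemma hasGrowthOn_invGammaPair_one : HasGrowthOn Set.univ (-1) π (invGammaPair 1) := by
  have h := (hasGrowthOn_invGammaPair_zero Set.univ).invGammaPair_add_one le_rfl
  norm_num at h
  exact h

lemma exists_norm_invGammaPair_one_le :
    ∃ C : ℝ, 0 ≤ C ∧ ∀ x : ℝ, ‖invGammaPair 1 x‖ ≤ C := by
  obtain ⟨C, hC, h⟩ := hasGrowthOn_invGammaPair_one
  refine ⟨C, hC, fun x ↦ (h x trivial).trans (mul_le_of_le_one_right hC ?_)⟩
  simpa using Real.rpow_le_one_of_one_le_of_nonpos (by simp) (by norm_num)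

lemma isEvenEntire_invGammaPair_one :
    IsEvenEntire (invGammaPair 1) 1 ((-2 * polygamma 1 1 : ℝ) : ℂ) := by
  simpa using isEvenEntire_invGammaPair one_pos

lemma exists_abs_besselJ_mul_le (n : ℕ) {lam : ℝ} (hlam : 0 < lam) :
    ∃ C : ℝ, 0 ≤ C ∧ ∀ t x : ℝ, lam ≤ t → 0 ≤ x →
      |besselJ n (t * x)| ≤ C * (1 + x) ^ (-(1 / 2) : ℝ) := by
  obtain ⟨C, hC, h⟩ := exists_abs_besselJ_le n
  obtain ⟨D, hD, h'⟩ := exists_one_add_mul_rpow_le hlam (-(1 / 2))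
  refine ⟨C * D, by positivity, fun t x ht hx ↦ ?_⟩
  have htx : 0 ≤ t * x := mul_nonneg (hlam.le.trans ht) hx
  refine (h _ htx).trans ?_
  rw [mul_assoc]
  refine mul_le_mul_of_nonneg_left (le_trans ?_ (h' x hx)) hC
  exact Real.rpow_le_rpow_of_nonpos (by positivity) (by gcongr) (by norm_num)

section Regularization

variable {g : ℂ → ℂ} {A S : ℂ} {e L lam : ℝ} {K : ℕ}

/-- The Hankel transform of an even entire function multiplied by a regularizing factor. -/
lemma integral_pow_mul_regularized_besselJ (hg : IsEvenEntire g A S)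
    (hgrow : HasGrowthOn Set.univ K L g) (hL : 0 ≤ L) (hlam : L ≤ lam) (n : ℕ)
    {δ : ℝ} (hδ : 0 < δ) :
    ∫ x in Set.Ioi (0 : ℝ), (x : ℂ) ^ n * (g x * invGammaPair 1 (δ * x) ^ (n + K + 2))
        * (besselJ (n + 3) ((lam + (n + K + 3 : ℕ) * (π * δ)) * x) : ℂ)
      = 1 / (lam + (n + K + 3 : ℕ) * (π * δ) : ℝ) * (2 / (lam + (n + K + 3 : ℕ) * (π * δ) : ℝ)) ^ n
        * ((2 / (lam + (n + K + 3 : ℕ) * (π * δ) : ℝ)) ^ 2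
            * ((n + 2).choose n * n.factorial
              * (A * (S + (n + K + 2 : ℕ) * (δ ^ 2 * (-2 * polygamma 1 1 : ℝ)))))
          + (n + 1) * (n.factorial * A)) := by
  have hE := hg.mul ((isEvenEntire_invGammaPair_one.comp_mul (δ : ℂ)).pow (n + K + 2))
  have hG : HasGrowthOn Set.univ (-2) (L + (n + K + 2 : ℕ) * (π * δ)) fun z ↦
      z ^ n * (g z * invGammaPair 1 (δ * z) ^ (n + K + 2)) := by
    have := ((hasGrowthOn_id Set.univ).pow n).mul (hgrow.mul
      ((hasGrowthOn_invGammaPair_one.comp_mul hδ fun _ _ ↦ trivial).pow (n + K + 2)))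
    convert this using 1
    · push_cast
      ring
    · ring
  have hπδ : 0 < π * δ := mul_pos Real.pi_pos hδ
  have h := IsPaleyWiener.integral_mul_besselJ_add_three (lam := lam + (n + K + 3 : ℕ) * (π * δ))
    (by positivity) (by push_cast; nlinarith) n _
    (hG.isPaleyWiener ((differentiable_id.pow n).mul hE.differentiable)) ?_ ?_
  · rw [h, hE.iteratedDeriv_pow_mul, hE.iteratedDeriv_pow_mul, if_pos (by omega), if_pos le_rfl,
      Nat.add_sub_cancel_left, Nat.sub_self, Nat.choose_self, iteratedDeriv_zero, hE.map_zero,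
      iteratedDeriv_succ, iteratedDeriv_one, hE.deriv_deriv]
    simp
  · intro z
    have := hE.neg z
    simp only [mul_neg] at this ⊢
    rw [this, neg_pow]
    ring
  · intro j hj
    rw [hE.iteratedDeriv_pow_mul, if_neg (by omega)]

/-- The Hankel transform of an even entire function at the edge of its Paley–Wiener range. -/
lemma integral_pow_mul_besselJ (hg : IsEvenEntire g A S)
    (hgrow : HasGrowthOn Set.univ K L g) (hL : 0 ≤ L) (hlam : L ≤ lam) (hlam0 : 0 < lam) (n : ℕ)
    (hreal : HasGrowthOn (Set.range ((↑) : ℝ → ℂ)) e L g) (he : n + e < -(1 / 2)) :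
    ∫ x in Set.Ioi (0 : ℝ), (x : ℂ) ^ n * g x * (besselJ (n + 3) (lam * x) : ℂ)
      = 1 / lam * (2 / lam) ^ n * ((2 / lam) ^ 2 * ((n + 2).choose n * n.factorial * (A * S))
          + (n + 1) * (n.factorial * A)) := by
  set N := n + K + 2 with hN
  obtain ⟨C₁, hC₁, h₁⟩ := hreal
  obtain ⟨C₂, hC₂, h₂⟩ := exists_norm_invGammaPair_one_le
  obtain ⟨C₃, hC₃, h₃⟩ := exists_abs_besselJ_mul_le (n + 3) hlam0
  have hR := (differentiable_invGammaPair 1).continuous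
  have hle : nhdsWithin (0 : ℝ) (Set.Ioi 0) ≤ nhds 0 := nhdsWithin_le_nhds
  have hlim : Filter.Tendsto (fun δ : ℝ ↦ ∫ x in Set.Ioi (0 : ℝ),
      (x : ℂ) ^ n * (g x * invGammaPair 1 (δ * x) ^ N)
        * (besselJ (n + 3) ((lam + (n + K + 3 : ℕ) * (π * δ)) * x) : ℂ)) (nhdsWithin 0 (Set.Ioi 0))
      (nhds (∫ x in Set.Ioi (0 : ℝ), (x : ℂ) ^ n * g x * (besselJ (n + 3) (lam * x) : ℂ))) := by
    refine tendsto_integral_filter_of_dominated_convergence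
      (fun x ↦ C₁ * C₂ ^ N * C₃ * (1 + ‖x‖) ^ (-(1 / 2 - e - n))) ?_ ?_ ?_ ?_
    · refine Filter.Eventually.of_forall fun δ ↦ Continuous.aestronglyMeasurable ?_
      have := hg.differentiable.continuous
      have := continuous_besselJ (n + 3)
      fun_prop
    · filter_upwards [self_mem_nhdsWithin] with δ hδ
      refine (ae_restrict_iff' measurableSet_Ioi).2 (Filter.Eventually.of_forall fun x hx ↦ ?_)
      have hx : 0 < x := hx
      have hδ : 0 < δ := hδ
      have b1 := h₁ x ⟨x, rfl⟩
      have b2 := h₂ (δ * x)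
      have b3 := h₃ (lam + (n + K + 3 : ℕ) * (π * δ)) x
        (le_add_of_nonneg_right (by positivity)) hx.le
      rw [Complex.norm_real, Real.norm_of_nonneg hx.le, Complex.ofReal_im, abs_zero, mul_zero,
        Real.exp_zero, mul_one] at b1
      rw [Complex.ofReal_mul] at b2
      rw [norm_mul, norm_mul, norm_mul, norm_pow, norm_pow, Complex.norm_real, Complex.norm_real,
        Real.norm_of_nonneg hx.le, Real.norm_eq_abs]
      have b4 : x ^ n ≤ (1 + x) ^ (n : ℝ) := by
        rw [Real.rpow_natCast]
        exact pow_le_pow_left₀ hx.le (by linarith) n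
      calc x ^ n * (‖g x‖ * ‖invGammaPair 1 (δ * x)‖ ^ N)
            * |besselJ (n + 3) ((lam + (n + K + 3 : ℕ) * (π * δ)) * x)|
          ≤ (1 + x) ^ (n : ℝ) * (C₁ * (1 + x) ^ e * C₂ ^ N)
            * (C₃ * (1 + x) ^ (-(1 / 2) : ℝ)) := by gcongr
        _ = C₁ * C₂ ^ N * C₃ * ((1 + x) ^ (n : ℝ) * (1 + x) ^ e * (1 + x) ^ (-(1 / 2) : ℝ)) := by
            ring
        _ = _ := by
            rw [← Real.rpow_add (by positivity), ← Real.rpow_add (by positivity)]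
            congr 2
            ring
    · exact ((integrable_one_add_norm (by simp; linarith)).const_mul _).integrableOn
    · refine Filter.Eventually.of_forall fun x ↦ ?_
      have hc : Continuous fun δ : ℝ ↦ (x : ℂ) ^ n * (g x * invGammaPair 1 (δ * x) ^ N)
          * (besselJ (n + 3) ((lam + (n + K + 3 : ℕ) * (π * δ)) * x) : ℂ) := by
        have := continuous_besselJ (n + 3)
        fun_prop
      have := (hc.tendsto 0).mono_left hle
      simpa [isEvenEntire_invGammaPair_one.map_zero] using this
  have hl : Filter.Tendsto (fun δ : ℝ ↦ ((lam + (n + K + 3 : ℕ) * (π * δ) : ℝ) : ℂ))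
      (nhdsWithin 0 (Set.Ioi 0)) (nhds (lam : ℂ)) := by
    have : Continuous fun δ : ℝ ↦ ((lam + (n + K + 3 : ℕ) * (π * δ) : ℝ) : ℂ) := by fun_prop
    simpa using (this.tendsto 0).mono_left hle
  have hq : Filter.Tendsto (fun δ : ℝ ↦ A * (S + (n + K + 2 : ℕ)
      * ((δ : ℂ) ^ 2 * (-2 * polygamma 1 1 : ℝ)))) (nhdsWithin 0 (Set.Ioi 0)) (nhds (A * S)) := by
    have : Continuous fun δ : ℝ ↦ A * (S + (n + K + 2 : ℕ)
      * ((δ : ℂ) ^ 2 * (-2 * polygamma 1 1 : ℝ))) := by fun_prop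
    simpa using (this.tendsto 0).mono_left hle
  have hl0 : (lam : ℂ) ≠ 0 := by exact_mod_cast hlam0.ne'
  have h1 := tendsto_const_nhds (x := (1 : ℂ)).div hl hl0
  have h2 := tendsto_const_nhds (x := (2 : ℂ)).div hl hl0
  refine tendsto_nhds_unique hlim (((h1.mul (h2.pow n)).mul
    (((h2.pow 2).mul (hq.const_mul _)).add_const _)).congr' ?_)
  filter_upwards [self_mem_nhdsWithin] with δ hδ
  exact (integral_pow_mul_regularized_besselJ hg hgrow hL hlam n hδ).symm

end Regularization

theorem hankel_gamma_second_term_even_order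
    (M : ℕ) (hM : 1 ≤ M) (α β : ℕ → ℝ)
    (hα : ∀ k ∈ Finset.range M, 0 < α k) (hβ : ∀ k ∈ Finset.range M, 0 < β k)
    (m : ℕ)
    (hαsum : (m : ℝ) + (1 / 2) * ((M : ℝ) + 3 / 2) < ∑ k ∈ Finset.range M, α k)
    (lam : ℝ) (hlam : π * ∑ k ∈ Finset.range M, β k ≤ lam) :
    ∫ x in Set.Ioi (0 : ℝ), x ^ (2 * m + 1) * besselJ (2 * m + 4) (lam * x) * gammaProd M α β x
      = ((Nat.factorial (2 * m + 2) : ℝ) / (2 * ∏ k ∈ Finset.range M, (Real.Gamma (α k)) ^ 2))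
          * (2 / lam) ^ (2 * (m + 1))
          * (1 - (4 * (2 * (m : ℝ) + 3) / lam ^ 2)
                * ∑ k ∈ Finset.range M, (β k) ^ 2 * polygamma 1 (α k)) := by
  have hL : 0 < π * ∑ k ∈ Finset.range M, β k :=
    mul_pos Real.pi_pos (Finset.sum_pos hβ (Finset.nonempty_range_iff.2 (by omega)))
  have hlam0 : 0 < lam := hL.trans_le hlam
  have hE := IsEvenEntire.prod (Finset.range M) fun k hk ↦
    (isEvenEntire_invGammaPair (hα k hk)).comp_mul (β k : ℂ)
  have hgrow : HasGrowthOn Set.univ M (π * ∑ k ∈ Finset.range M, β k) fun z ↦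
      ∏ k ∈ Finset.range M, invGammaPair (α k) (β k * z) := by
    have := HasGrowthOn.prod (Finset.range M) fun k hk ↦
      (hasGrowthOn_univ_invGammaPair (hα k hk).le).comp_mul (hβ k hk) fun _ _ ↦ trivial
    simpa [Finset.mul_sum] using this
  have hreal : HasGrowthOn (Set.range ((↑) : ℝ → ℂ)) (M - 2 * ∑ k ∈ Finset.range M, α k)
      (π * ∑ k ∈ Finset.range M, β k) fun z ↦
      ∏ k ∈ Finset.range M, invGammaPair (α k) (β k * z) := by
    have := HasGrowthOn.prod (Finset.range M) fun k hk ↦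
      (hasGrowthOn_real_invGammaPair (hα k hk).le).comp_mul (hβ k hk) (by
        rintro _ ⟨x, rfl⟩
        exact ⟨β k * x, by push_cast; rfl⟩)
    simpa [Finset.mul_sum] using this
  have h := integral_pow_mul_besselJ hE hgrow hL.le hlam hlam0 (2 * m + 1) hreal
    (by push_cast; linarith)
  have hinteg : ∀ x : ℝ, (x : ℂ) ^ (2 * m + 1)
      * (∏ k ∈ Finset.range M, invGammaPair (α k) (β k * x))
      * (besselJ (2 * m + 1 + 3) (lam * x) : ℂ)
      = ((x ^ (2 * m + 1) * besselJ (2 * m + 4) (lam * x) * gammaProd M α β x : ℝ) : ℂ) := by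
    intro x
    have : ∀ k, invGammaPair (α k) (β k * x)
        = (((Real.Gamma (α k + β k * x) * Real.Gamma (α k - β k * x))⁻¹ : ℝ) : ℂ) := fun k ↦ by
      rw [← invGammaPair_ofReal, Complex.ofReal_mul]
    simp_rw [this]
    rw [gammaProd]
    push_cast
    ring
  simp_rw [hinteg] at h
  rw [integral_complex_ofReal] at h
  apply Complex.ofReal_injective
  rw [h]
  have hP : ∏ k ∈ Finset.range M, Real.Gamma (α k) ^ 2 ≠ 0 := Finset.prod_ne_zero_iff.2
    fun k hk ↦ pow_ne_zero 2 (Real.Gamma_pos_of_pos (hα k hk)).ne'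
  have hS : ∑ k ∈ Finset.range M, (β k : ℂ) ^ 2 * ((-2 * polygamma 1 (α k) : ℝ) : ℂ)
      = ((-2 * ∑ k ∈ Finset.range M, β k ^ 2 * polygamma 1 (α k) : ℝ) : ℂ) := by
    push_cast
    rw [Finset.mul_sum]
    exact Finset.sum_congr rfl fun k _ ↦ by ring
  rw [hS, ← Complex.ofReal_prod, Finset.prod_inv_distrib]
  set P := ∏ k ∈ Finset.range M, Real.Gamma (α k) ^ 2
  set T := ∑ k ∈ Finset.range M, β k ^ 2 * polygamma 1 (α k)
  have hchoose : ((2 * m + 1 + 2).choose (2 * m + 1) : ℝ) = (2 * m + 3) * (2 * m + 2) / 2 := by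
    rw [Nat.choose_symm_add, Nat.cast_choose_two]
    push_cast
    ring
  have hfact : ((2 * m + 2).factorial : ℝ) = (2 * m + 2) * (2 * m + 1).factorial := by
    rw [Nat.factorial_succ]
    push_cast
    ring
  have key : 1 / lam * (2 / lam) ^ (2 * m + 1) * ((2 / lam) ^ 2
      * ((2 * m + 1 + 2).choose (2 * m + 1) * (2 * m + 1).factorial * (P⁻¹ * (-2 * T)))
      + ((2 * m + 1 : ℕ) + 1) * ((2 * m + 1).factorial * P⁻¹))
      = (2 * m + 2).factorial / (2 * P) * (2 / lam) ^ (2 * (m + 1))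
        * (1 - 4 * (2 * m + 3) / lam ^ 2 * T) := by
    rw [hchoose, hfact, show 2 * (m + 1) = 2 * m + 1 + 1 by ring, pow_succ (2 / lam) (2 * m + 1)]
    push_cast
    field_simp
    ring
  rw [← key]
  push_cast
  ring
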